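/- arXiv:2401.05522 — 2 statements merged into one kernel-verified Lean document; each statement's English description precedes it below -/
import Mathlib

section
/- Let r ≥ 1 be an integer and define G_r(n) = (−1)^r · Δ^r ( (1/n)·log( p̄(n)/T̂(n) ) ), where T̂(n) = (1/(8n))·(1 − 1/(π√n))·e^{π√n}. Then for all integers n ≥ N_1(r), one has |G_r(n)| < 1/n^{r+3/2}. -/
open Real

/-- The overpartition function. -/
noncomputable def pbar (n : ℕ) : ℕ :=
  ∑ k ∈ Finset.range (n + 1),
    (Nat.Partition.distincts k).card * Fintype.card (Nat.Partition (n - k))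

/-- Forward difference operator. -/
noncomputable def fdiff (f : ℕ → ℝ) : ℕ → ℝ := fun n => f (n + 1) - f n

/-- The main term `T̂(n) = (1/(8n))·(1 − 1/(π√n))·e^{π√n}`. -/
noncomputable def That (n : ℕ) : ℝ :=
  (1 / (8 * (n : ℝ))) * (1 - 1 / (π * Real.sqrt n)) * Real.exp (π * Real.sqrt n)

noncomputable def N₀ (m : ℕ) : ℝ :=
  if m = 1 then 1 else 2 * m * Real.log m - m * Real.log (Real.log m)

noncomputable def N₁ (r : ℕ) : ℝ :=
  max (85 : ℝ) ((⌈(4 / π ^ 2) * (N₀ (2 * r + 2)) ^ 2⌉ : ℤ) : ℝ)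

/-- `G_r(n) = (−1)^r Δ^r ((1/n) log (p̄(n)/T̂(n)))`. -/
noncomputable def G (r : ℕ) (n : ℕ) : ℝ :=
  (-1 : ℝ) ^ r * (fdiff^[r] (fun m => (1 / (m : ℝ)) * Real.log ((pbar m : ℝ) / That m))) n

open PowerSeries in
/-- The partial products of a convergent infinite product of power series `1 + O(X ^ (i + 1))`
agree with the product up to `O(X ^ (n + 1))`. -/
lemma PowerSeries.X_pow_dvd_sub_prod_range {R : Type*} [CommRing R] [TopologicalSpace R]
    [DiscreteTopology R] {f : ℕ → R⟦X⟧} {a : R⟦X⟧}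
    (h : @HasProd _ _ _ (PowerSeries.WithPiTopology.instTopologicalSpace R) f a
      (SummationFilter.unconditional ℕ))
    (hf : ∀ i, X ^ (i + 1) ∣ f i - 1) (n : ℕ) :
    X ^ (n + 1) ∣ a - ∏ i ∈ Finset.range n, f i := by
  let _ := PowerSeries.WithPiTopology.instTopologicalSpace R
  rw [X_pow_dvd_iff]
  intro m hm
  have step : ∀ N, n ≤ N → X ^ (n + 1) ∣
      ∏ i ∈ Finset.range N, f i - ∏ i ∈ Finset.range n, f i := by
    intro N hN
    induction N, hN using Nat.le_induction with
    | base => simp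
    | succ N hN ih =>
      rw [Finset.prod_range_succ]
      have h1 := ((pow_dvd_pow (X : R⟦X⟧) (Nat.succ_le_succ hN)).trans (hf N)).mul_left
        (∏ i ∈ Finset.range N, f i)
      have := dvd_add ih h1
      convert this using 1
      ring
  have h1 : Filter.Tendsto (fun N => coeff m (∏ i ∈ Finset.range N, f i)) Filter.atTop
      (nhds (coeff m a)) :=
    ((PowerSeries.WithPiTopology.continuous_coeff R m).tendsto a).comp h.tendsto_prod_nat
  have h2 : Filter.Tendsto (fun N => coeff m (∏ i ∈ Finset.range N, f i)) Filter.atTop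
      (nhds (coeff m (∏ i ∈ Finset.range n, f i))) := by
    refine tendsto_const_nhds.congr' ?_
    filter_upwards [Filter.eventually_ge_atTop n] with N hN
    have := (X_pow_dvd_iff.1 (step N hN)) m hm
    rw [map_sub, sub_eq_zero] at this
    exact this.symm
  rw [map_sub, tendsto_nhds_unique h1 h2, sub_self]

/-- A finite form of the alternating theta series: if `c m = (1 - q ^ (m + 1)) c (m + 1)`, then
`∑_{|k| ≤ n} (-1) ^ k q ^ (k ^ 2) c (n - k) c (n + k)` satisfies a two-term recurrence. -/
lemma theta_bailey_step {R : Type*} [CommRing R] (q : R) (c : ℕ → R)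
    (hc : ∀ m, c m = (1 - q ^ (m + 1)) * c (m + 1)) (n : ℕ) :
    (1 - q ^ (2 * (n + 1))) * (c (n + 1) ^ 2 + 2 * ∑ k ∈ Finset.range (n + 1),
        (-1) ^ (k + 1) * q ^ ((k + 1) ^ 2) * (c (n - k) * c (n + 1 + (k + 1)))) =
      c n ^ 2 + 2 * ∑ k ∈ Finset.range n,
        (-1) ^ (k + 1) * q ^ ((k + 1) ^ 2) * (c (n - (k + 1)) * c (n + (k + 1))) := by
  have key : ∀ K ≤ n, (1 - q ^ (2 * (n + 1))) * (c (n + 1) ^ 2 + 2 * ∑ k ∈ Finset.range K,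
        (-1) ^ (k + 1) * q ^ ((k + 1) ^ 2) * (c (n - k) * c (n + 1 + (k + 1)))) =
      c n ^ 2 + 2 * ∑ k ∈ Finset.range K,
        (-1) ^ (k + 1) * q ^ ((k + 1) ^ 2) * (c (n - (k + 1)) * c (n + (k + 1)))
      + 2 * q ^ (n + 1) * (-1) ^ K * (q ^ (K * (K + 1)) * (c (n - K) * c (n + 1 + K))) := by
    intro K hK
    induction K with
    | zero =>
      simp only [Finset.range_zero, Finset.sum_empty, pow_zero, zero_mul, Nat.sub_zero, Nat.add_zero]
      rw [hc n]
      ring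
    | succ K ih =>
      have ih := ih (by omega)
      rw [Finset.sum_range_succ, Finset.sum_range_succ, mul_add (2 : R), ← add_assoc (c (n + 1) ^ 2),
        mul_add (1 - q ^ (2 * (n + 1))), ih]
      obtain ⟨d, rfl⟩ : ∃ d, n = K + 1 + d := ⟨n - (K + 1), by omega⟩
      have e1 : K + 1 + d - K = d + 1 := by omega
      have e2 : K + 1 + d - (K + 1) = d := by omega
      rw [e1, e2, hc d]
      have e3 : K + 1 + d + (K + 1) = K + 1 + d + 1 + K := by omega
      rw [e3, hc (K + 1 + d + 1 + K)]
      have e4 : K + 1 + d + 1 + (K + 1) = K + 1 + d + 1 + K + 1 := by omega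
      rw [e4]
      ring
  rw [Finset.sum_range_succ, mul_add (2 : R), ← add_assoc (c (n + 1) ^ 2),
    mul_add (1 - q ^ (2 * (n + 1))), key n le_rfl, Nat.sub_self]
  have e3 : n + 1 + n = n + (n + 1) := by omega
  have e4 : n + 1 + (n + 1) = n + (n + 1) + 1 := by omega
  rw [e3, e4, hc (n + (n + 1))]
  ring

open PowerSeries in
/-- The power series `1 + 2 ∑ (-1) ^ k X ^ (k ^ 2)`. -/
noncomputable def altTheta : ℤ⟦X⟧ :=
  PowerSeries.mk fun n => if n = 0 then 1 else if IsSquare n then 2 * (-1) ^ n else 0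

open PowerSeries in
lemma X_pow_dvd_altTheta_sub (n : ℕ) : X ^ (n + 1) ∣
    altTheta - (1 + 2 * ∑ k ∈ Finset.range n, (-1) ^ (k + 1) * X ^ ((k + 1) ^ 2)) := by
  rw [X_pow_dvd_iff]
  intro m hm
  have h2 : (2 : ℤ⟦X⟧) = C 2 := by simp
  have h1 : ∀ k : ℕ, ((-1 : ℤ⟦X⟧)) ^ (k + 1) = C ((-1) ^ (k + 1)) := by intro k; simp
  simp only [altTheta, map_sub, coeff_mk, map_add, h2, coeff_C_mul, map_sum, h1, coeff_X_pow,
    coeff_one]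
  rcases Nat.eq_zero_or_pos m with rfl | hm0
  · simp [eq_comm (a := 0)]
  simp only [hm0.ne', if_false, zero_add]
  split_ifs with hs
  · obtain ⟨j, rfl⟩ := hs
    have hj : 0 < j := by
      rcases Nat.eq_zero_or_pos j with rfl | h
      · simp at hm0
      · exact h
    rw [Finset.sum_eq_single (j - 1)]
    · have : j - 1 + 1 = j := by omega
      rw [this, if_pos (by ring), ← pow_two, mul_one]
      have : ((-1 : ℤ)) ^ (j ^ 2) = (-1) ^ j := by
        rcases Nat.even_or_odd j with h | h
        · rw [h.neg_one_pow, (h.pow_of_ne_zero two_ne_zero).neg_one_pow]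
        · rw [h.neg_one_pow, h.pow.neg_one_pow]
      rw [this, sub_self]
    · intro b _ hb
      rw [if_neg, mul_zero]
      intro h
      have : j = b + 1 := Nat.pow_left_injective two_ne_zero ((pow_two j).trans h)
      omega
    · intro h
      exfalso
      apply h
      rw [Finset.mem_range]
      nlinarith [Nat.sub_add_cancel hj]
  · rw [Finset.sum_eq_zero]
    · simp
    · intro k _
      rw [if_neg, mul_zero]
      rintro rfl
      exact hs ⟨k + 1, by ring⟩

open PowerSeries PowerSeries.WithPiTopology in
/-- Gauss' identity, as a statement about overpartitions. -/
lemma mk_pbar_mul_altTheta : (PowerSeries.mk fun n => (pbar n : ℤ)) * altTheta = 1 := by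
  set c : ℕ → ℤ⟦X⟧ := fun n => ∏ i ∈ Finset.range n, ∑' j : ℕ, X ^ ((i + 1) * j) with hcdef
  have hinv : ∀ i : ℕ, (1 - X ^ (i + 1)) * (∑' j : ℕ, X ^ ((i + 1) * j) : ℤ⟦X⟧) = 1 := by
    intro i
    simp_rw [pow_mul]
    exact one_sub_mul_tsum_pow_of_constantCoeff_eq_zero (by simp)
  have hc : ∀ m, c m = (1 - X ^ (m + 1)) * c (m + 1) := by
    intro m
    simp only [hcdef, Finset.prod_range_succ]
    rw [mul_left_comm, hinv, mul_one]
  set P : ℤ⟦X⟧ := PowerSeries.mk fun n => (Fintype.card (Nat.Partition n) : ℤ) with hP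
  set D : ℤ⟦X⟧ := PowerSeries.mk fun n => ((Nat.Partition.distincts n).card : ℤ) with hD
  have hPD : (PowerSeries.mk fun n => (pbar n : ℤ)) = D * P := by
    ext n
    rw [coeff_mul, Finset.Nat.sum_antidiagonal_eq_sum_range_succ_mk]
    simp [pbar, hD, hP]
  have hPc : ∀ n, X ^ (n + 1) ∣ P - c n := by
    intro n
    refine X_pow_dvd_sub_prod_range ?_ (fun i => ?_) n
    · have := Nat.Partition.hasProd_powerSeriesMk_card_restricted ℤ (fun _ => True)
      simpa [Nat.Partition.restricted] using this
    · refine ⟨∑' j : ℕ, X ^ ((i + 1) * j), ?_⟩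
      linear_combination hinv i
  have hDd : ∀ n, X ^ (n + 1) ∣ D - ∏ i ∈ Finset.range n, (1 + X ^ (i + 1)) := by
    intro n
    refine X_pow_dvd_sub_prod_range ?_ (fun i => ?_) n
    · have := Nat.Partition.hasProd_powerSeriesMk_card_countRestricted ℤ (m := 2) (by norm_num)
      simpa [Nat.Partition.countRestricted_two, Finset.sum_range_succ] using this
    · simp
  have hS : ∀ n, (∏ i ∈ Finset.range n, (1 - X ^ (2 * (i + 1)))) *
      (c n ^ 2 + 2 * ∑ k ∈ Finset.range n,
        (-1) ^ (k + 1) * X ^ ((k + 1) ^ 2) * (c (n - (k + 1)) * c (n + (k + 1)))) = 1 := by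
    intro n
    induction n with
    | zero => simp [hcdef]
    | succ n ih =>
      rw [← theta_bailey_step X c hc n] at ih
      simpa only [Finset.prod_range_succ, mul_assoc, Nat.add_sub_add_right] using ih
  have hcd : ∀ n, (∏ i ∈ Finset.range n, (1 - X ^ (2 * (i + 1)))) * c n =
      ∏ i ∈ Finset.range n, (1 + X ^ (i + 1) : ℤ⟦X⟧) := by
    intro n
    rw [hcdef, ← Finset.prod_mul_distrib]
    refine Finset.prod_congr rfl fun i _ => ?_
    linear_combination (1 + X ^ (i + 1)) * hinv i
  have hdvd : ∀ n, X ^ (n + 1) ∣ (c n ^ 2 + 2 * ∑ k ∈ Finset.range n,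
        (-1) ^ (k + 1) * X ^ ((k + 1) ^ 2) * (c (n - (k + 1)) * c (n + (k + 1)))) -
        P ^ 2 * altTheta := by
    intro n
    have h1 : X ^ (n + 1) ∣ c n ^ 2 - P ^ 2 := by
      rw [sq_sub_sq, ← neg_sub P]
      exact ((hPc n).neg_right).mul_left _
    have h2 : ∀ k ∈ Finset.range n, X ^ (n + 1) ∣ (-1) ^ (k + 1) * X ^ ((k + 1) ^ 2) *
        (c (n - (k + 1)) * c (n + (k + 1)) - P ^ 2) := by
      intro k hk
      have hk := Finset.mem_range.1 hk
      have h3 : X ^ (n - k) ∣ c (n - (k + 1)) * c (n + (k + 1)) - P ^ 2 := by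
        have e1 : X ^ (n - k) ∣ P - c (n - (k + 1)) := by
          have := hPc (n - (k + 1))
          rwa [show n - (k + 1) + 1 = n - k by omega] at this
        have e2 : X ^ (n - k) ∣ P - c (n + (k + 1)) :=
          (pow_dvd_pow _ (by omega)).trans (hPc _)
        convert dvd_sub ((e1.mul_right (c (n + (k + 1)))).neg_right) (e2.mul_left P) using 1
        ring
      have h4 : (X : ℤ⟦X⟧) ^ (n + 1) ∣ X ^ ((k + 1) ^ 2) * X ^ (n - k) := by
        rw [← pow_add]
        refine pow_dvd_pow _ ?_
        have : k + 1 ≤ (k + 1) ^ 2 := Nat.le_self_pow two_ne_zero _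
        omega
      rw [mul_assoc]
      exact (h4.trans (mul_dvd_mul_left _ h3)).mul_left _
    have h3 := Finset.dvd_sum h2
    have h4 := X_pow_dvd_altTheta_sub n
    convert dvd_sub (dvd_add h1 (h3.mul_left 2)) (h4.mul_left (P ^ 2)) using 1
    simp only [mul_sub, Finset.sum_sub_distrib, ← Finset.sum_mul]
    ring
  have hfin : ∀ n, X ^ (n + 1) ∣ D * P * altTheta - 1 := by
    intro n
    have h1 := (hDd n).mul_right (P * altTheta)
    rw [← hcd] at h1
    have h2 := (hPc n).mul_left ((∏ i ∈ Finset.range n, (1 - X ^ (2 * (i + 1)))) * P * altTheta)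
    have h3 := (hdvd n).mul_left (∏ i ∈ Finset.range n, (1 - X ^ (2 * (i + 1))))
    rw [mul_sub, hS] at h3
    convert dvd_sub (dvd_sub h1 h2) h3 using 1
    ring
  rw [hPD, ← sub_eq_zero]
  ext m
  simpa using (X_pow_dvd_iff.1 (hfin m)) m (Nat.lt_succ_self m)

open PowerSeries in
/-- Cauchy's formula for the coefficients of the reciprocal of a power series that converges to a
nonvanishing function on the unit disc. -/
lemma PowerSeries.coeff_eq_circleIntegral_inv {A P : ℂ⟦X⟧} (hPA : P * A = 1) {g : ℂ → ℂ}
    (hg : ∀ z : ℂ, ‖z‖ < 1 → HasSum (fun n => coeff n A * z ^ n) (g z))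
    (hne : ∀ z : ℂ, ‖z‖ < 1 → g z ≠ 0) {R : ℝ} (hR : 0 < R) (hR1 : R < 1) (n : ℕ) :
    coeff n P = (2 * π * Complex.I)⁻¹ • ∮ z in C(0, R), (1 / (z - 0)) ^ n • (z - 0)⁻¹ • (g z)⁻¹ := by
  set p : FormalMultilinearSeries ℂ ℂ ℂ := FormalMultilinearSeries.ofScalars ℂ (fun n => coeff n A)
  have hp : HasFPowerSeriesOnBall g p 0 1 := by
    refine ⟨?_, one_pos, ?_⟩
    · refine ENNReal.le_of_forall_nnreal_lt fun r hr => ?_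
      have hr' : ‖((r : ℝ) : ℂ)‖ < 1 := by simpa using hr
      refine p.le_radius_of_summable_norm ?_
      have := (hg _ hr').summable.norm
      refine this.congr fun n => ?_
      simp [p]
    · intro y hy
      have hy' : ‖y‖ₑ < 1 := by simpa using hy
      rw [← ofReal_norm, ENNReal.ofReal_lt_one] at hy'
      rw [zero_add]
      have h := hg y hy'
      refine h.congr_fun fun n => ?_
      simp [p, mul_comm]
  have hd : DifferentiableOn ℂ (fun z => (g z)⁻¹) (Metric.closedBall 0 R) := by
    have h1 : DifferentiableOn ℂ g (Metric.closedBall 0 R) := by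
      refine hp.differentiableOn.mono fun z hz => ?_
      have : ‖z‖ < 1 := (mem_closedBall_zero_iff.1 hz).trans_lt hR1
      rw [Metric.mem_eball, edist_zero_right, ← ofReal_norm, ENNReal.ofReal_lt_one]
      exact this
    exact h1.inv fun z hz => hne z ((mem_closedBall_zero_iff.1 hz).trans_lt hR1)
  lift R to NNReal using hR.le
  have hf := hd.hasFPowerSeriesOnBall (by exact_mod_cast hR)
  set s := cauchyPowerSeries (fun z => (g z)⁻¹) 0 R with hs
  have hprod : HasFPowerSeriesAt (fun _ => (1 : ℂ)) (FormalMultilinearSeries.ofScalars ℂ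
      (fun n => coeff n (PowerSeries.mk s.coeff * A))) 0 := by
    rw [hasFPowerSeriesAt_iff]
    have hball : Metric.ball (0 : ℂ) R ∈ nhds 0 := Metric.ball_mem_nhds _ hR
    filter_upwards [hball] with z hz
    have hz' := mem_ball_zero_iff.1 hz
    have hz1 : ‖z‖ < 1 := hz'.trans hR1
    have hs1 : HasSum (fun n => s.coeff n * z ^ n) (g z)⁻¹ := by
      have := hf.hasSum (y := z) (by
        rw [Metric.mem_eball, edist_zero_right, ← ofReal_norm]
        exact (ENNReal.ofReal_lt_ofReal_iff hR).2 hz' |>.trans_eq ENNReal.ofReal_coe_nnreal)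
      simpa [mul_comm] using this
    have h1 := summable_norm_sum_mul_antidiagonal_of_summable_norm hs1.summable.norm
      (hg z hz1).summable.norm
    have h2 := tsum_mul_tsum_eq_tsum_sum_antidiagonal_of_summable_norm hs1.summable.norm
      (hg z hz1).summable.norm
    rw [hs1.tsum_eq, (hg z hz1).tsum_eq, inv_mul_cancel₀ (hne z hz1)] at h2
    rw [h2]
    convert h1.of_norm.hasSum using 1
    funext n
    rw [FormalMultilinearSeries.coeff_ofScalars, coeff_mul, smul_eq_mul, Finset.mul_sum]
    refine Finset.sum_congr rfl fun ij hij => ?_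
    rw [coeff_mk, ← Finset.HasAntidiagonal.mem_antidiagonal.1 hij, pow_add]
    ring
  have hone : HasFPowerSeriesAt (fun _ => (1 : ℂ)) (FormalMultilinearSeries.ofScalars ℂ
      (fun n => coeff n (1 : ℂ⟦X⟧))) 0 := by
    rw [hasFPowerSeriesAt_iff]
    refine Filter.Eventually.of_forall fun z => ?_
    have h := hasSum_single (f := fun n => z ^ n • (FormalMultilinearSeries.ofScalars ℂ
      (fun n => coeff n (1 : ℂ⟦X⟧))).coeff n) 0 fun n hn => by
        simp [FormalMultilinearSeries.coeff_ofScalars, coeff_one, hn]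
    simpa [FormalMultilinearSeries.coeff_ofScalars] using h
  have heq : PowerSeries.mk s.coeff * A = 1 := by
    have h1 := FormalMultilinearSeries.ofScalars_series_injective ℂ ℂ
      (hprod.eq_formalMultilinearSeries hone)
    ext n
    exact congrFun h1 n
  have hP : P = PowerSeries.mk s.coeff := by
    calc P = PowerSeries.mk s.coeff * A * P := by rw [heq, one_mul]
      _ = PowerSeries.mk s.coeff := by rw [mul_assoc, mul_comm A, hPA, mul_one]
  rw [hP, coeff_mk, ← cauchyPowerSeries_apply]
  rfl

open PowerSeries in
lemma hasSum_altTheta {τ : ℂ} (hτ : 0 < τ.im) :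
    HasSum (fun n => ((coeff n altTheta : ℤ) : ℂ) * Complex.exp (π * Complex.I * τ) ^ n)
      (jacobiTheta (τ + 1)) := by
  have h := (hasSum_nat_jacobiTheta (τ := τ + 1) (by simpa using hτ)).mul_left 2
  rw [mul_div_cancel₀ _ (two_ne_zero' ℂ)] at h
  have hinj : Function.Injective (fun n : ℕ => (n + 1) ^ 2 - 1) := by
    intro m n hmn
    have h1 : 0 < (m + 1) ^ 2 := by positivity
    have h2 : 0 < (n + 1) ^ 2 := by positivity
    have : (m + 1) ^ 2 = (n + 1) ^ 2 := by simp only at hmn; omega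
    have := Nat.pow_left_injective two_ne_zero this
    omega
  have h2 : HasSum (fun n => ((coeff (n + 1) altTheta : ℤ) : ℂ) *
      Complex.exp (π * Complex.I * τ) ^ (n + 1)) (jacobiTheta (τ + 1) - 1) := by
    rw [← hinj.hasSum_iff]
    · refine h.congr_fun fun n => ?_
      have h1 : 0 < (n + 1) ^ 2 := by positivity
      have e : (n + 1) ^ 2 - 1 + 1 = (n + 1) ^ 2 := by omega
      dsimp only [Function.comp]
      rw [e, altTheta, coeff_mk, if_neg h1.ne', if_pos (IsSquare.sq (n + 1)), mul_add, Complex.exp_add, ← Complex.exp_nat_mul]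
      have e3 : Complex.exp (π * Complex.I * ((n : ℂ) + 1) ^ 2 * 1) = (-1) ^ ((n + 1) ^ 2) := by
        rw [← Complex.exp_pi_mul_I, ← Complex.exp_nat_mul]
        congr 1
        push_cast
        ring
      rw [e3]
      push_cast
      rw [show ((n : ℂ) + 1) ^ 2 * (π * Complex.I * τ) = π * Complex.I * ((n : ℂ) + 1) ^ 2 * τ by ring]
      ring
    · intro m hm
      have : ¬ IsSquare (m + 1) := by
        rintro ⟨k, hk⟩
        have hk0 : 0 < k := by
          rcases Nat.eq_zero_or_pos k with rfl | h
          · simp at hk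
          · exact h
        exact hm ⟨k - 1, by simp only [Nat.sub_add_cancel hk0, pow_two, ← hk]; omega⟩
      simp [altTheta, this]
  rw [← hasSum_nat_add_iff' 1]
  simpa [altTheta] using h2

/-- Every point of the punctured unit disc is `exp (π * I * τ)` with `τ` in the upper half
plane. -/
lemma exists_exp_pi_I_mul {z : ℂ} (hz : ‖z‖ < 1) (hz0 : z ≠ 0) :
    ∃ τ : ℂ, 0 < τ.im ∧ Complex.exp (π * Complex.I * τ) = z := by
  have hpi : (π : ℂ) ≠ 0 := by exact_mod_cast pi_ne_zero
  refine ⟨Complex.log z / (π * Complex.I), ?_, ?_⟩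
  · have e : Complex.log z / (π * Complex.I) = (π⁻¹ : ℝ) * (-(Complex.log z * Complex.I)) := by
      push_cast
      field_simp
      rw [Complex.I_sq]
      ring
    rw [e, Complex.im_ofReal_mul]
    simp only [Complex.neg_im, Complex.mul_im, Complex.I_re, Complex.I_im, Complex.log_re]
    have := Real.log_neg (norm_pos_iff.2 hz0) hz
    have h2 := inv_pos.2 pi_pos
    nlinarith
  · rw [mul_div_cancel₀ _ (mul_ne_zero hpi Complex.I_ne_zero), Complex.exp_log hz0]

open PowerSeries in
/-- Overpartition numbers as Fourier coefficients of the reciprocal of a theta function. -/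
lemma pbar_eq_integral (hne : ∀ τ : ℂ, 0 < τ.im → jacobiTheta (τ + 1) ≠ 0) (n : ℕ) {y : ℝ}
    (hy : 0 < y) :
    (pbar n : ℂ) = 1 / 2 * ∫ x in (-1 : ℝ)..1, Complex.exp (π * n * (y + x * Complex.I)) *
      (jacobiTheta (Complex.I * (y + x * Complex.I) + 1))⁻¹ := by
  set A : ℂ⟦X⟧ := PowerSeries.map (Int.castRingHom ℂ) altTheta with hA
  set P : ℂ⟦X⟧ := PowerSeries.map (Int.castRingHom ℂ) (PowerSeries.mk fun n => (pbar n : ℤ)) with hP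
  have hPA : P * A = 1 := by rw [hA, hP, ← map_mul, mk_pbar_mul_altTheta, map_one]
  set g : ℂ → ℂ := fun z => ∑' n, coeff n A * z ^ n with hgdef
  have hgθ : ∀ τ : ℂ, 0 < τ.im → HasSum (fun n => coeff n A * Complex.exp (π * Complex.I * τ) ^ n)
      (jacobiTheta (τ + 1)) := fun τ hτ => by simpa [hA] using hasSum_altTheta hτ
  have hg0 : HasSum (fun n => coeff n A * 0 ^ n) 1 := by
    convert hasSum_single (α := ℂ) 0 ?_ using 1
    · simp [hA, altTheta]
    · intro n hn
      simp [hn]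
  have hg : ∀ z : ℂ, ‖z‖ < 1 → HasSum (fun n => coeff n A * z ^ n) (g z) := by
    intro z hz
    rcases eq_or_ne z 0 with rfl | hz0
    · exact hg0.summable.hasSum
    · obtain ⟨τ, hτ, rfl⟩ := exists_exp_pi_I_mul hz hz0
      exact (hgθ τ hτ).summable.hasSum
  have hgne : ∀ z : ℂ, ‖z‖ < 1 → g z ≠ 0 := by
    intro z hz
    rcases eq_or_ne z 0 with rfl | hz0
    · rw [hgdef]
      simp only [hg0.tsum_eq]
      exact one_ne_zero
    · obtain ⟨τ, hτ, rfl⟩ := exists_exp_pi_I_mul hz hz0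
      simp only [hgdef, (hgθ τ hτ).tsum_eq]
      exact hne τ hτ
  have hmain := coeff_eq_circleIntegral_inv hPA hg hgne (R := rexp (-(π * y))) (exp_pos _)
    (by rw [Real.exp_lt_one_iff]; nlinarith [pi_pos]) n
  have hcP : coeff n P = (pbar n : ℂ) := by simp [hP]
  set K : ℝ → ℂ := fun θ =>
    (circleMap 0 (rexp (-(π * y))) θ)⁻¹ ^ n * (g (circleMap 0 (rexp (-(π * y))) θ))⁻¹ with hK
  have hKper : Function.Periodic K (2 * π) := fun θ => by
    simp only [hK, periodic_circleMap 0 _ θ]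
  have hcirc : ∮ z in C(0, rexp (-(π * y))), (1 / (z - 0)) ^ n • (z - 0)⁻¹ • (g z)⁻¹ =
      Complex.I * ∫ θ in (0 : ℝ)..2 * π, K θ := by
    rw [circleIntegral, ← intervalIntegral.integral_const_mul]
    refine intervalIntegral.integral_congr fun θ _ => ?_
    have h0 : circleMap 0 (rexp (-(π * y))) θ ≠ 0 := circleMap_ne_center (exp_pos _).ne'
    simp only [deriv_circleMap, smul_eq_mul, hK, sub_zero, one_div]
    field_simp
  have hshift : ∫ θ in (0 : ℝ)..2 * π, K θ = ∫ θ in (-π)..π, K θ := by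
    have := hKper.intervalIntegral_add_eq 0 (-π)
    rw [zero_add] at this
    rw [this]
    congr 1
    ring
  have hsub := intervalIntegral.smul_integral_comp_sub_mul (a := -1) (b := 1) K π 0
  rw [mul_one, mul_neg_one, zero_sub, zero_sub, neg_neg] at hsub
  rw [← hcP, hmain, hcirc, hshift, ← hsub]
  have hcongr : ∫ x in (-1 : ℝ)..1, K (0 - π * x) = ∫ x in (-1 : ℝ)..1,
      Complex.exp (π * n * (y + x * Complex.I)) *
        (jacobiTheta (Complex.I * (y + x * Complex.I) + 1))⁻¹ := by
    refine intervalIntegral.integral_congr fun x _ => ?_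
    have e : circleMap 0 (rexp (-(π * y))) (0 - π * x) =
        Complex.exp (π * Complex.I * (Complex.I * (y + x * Complex.I))) := by
      rw [circleMap, zero_add, Complex.ofReal_exp, ← Complex.exp_add]
      congr 1
      push_cast
      linear_combination (-π * y - π * x * Complex.I) * Complex.I_sq
    simp only [hK, e]
    rw [show g _ = _ from (hgθ (Complex.I * (y + x * Complex.I)) (by simpa using hy)).tsum_eq,
      ← Complex.exp_neg, ← Complex.exp_nat_mul]
    congr 2
    linear_combination (-π * n * (y + x * Complex.I)) * Complex.I_sq
  rw [hcongr, smul_eq_mul, Complex.real_smul]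
  have hpi : (π : ℂ) ≠ 0 := by exact_mod_cast pi_ne_zero
  have hI := Complex.I_ne_zero
  field_simp

lemma jacobiTheta₂_half_eq (τ : ℂ) : jacobiTheta₂ (1 / 2) τ = jacobiTheta (τ + 1) := by
  rw [jacobiTheta, jacobiTheta₂]
  refine tsum_congr fun n => ?_
  rw [jacobiTheta₂_term, Complex.exp_add, mul_add, Complex.exp_add, mul_comm]
  congr 1
  obtain ⟨k, hk⟩ : Even (n ^ 2 - n) := by
    rw [pow_two, ← mul_sub_one]
    exact Int.even_mul_pred_self n
  have hk' : (n : ℂ) ^ 2 = n + k + k := by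
    have : n ^ 2 = n + k + k := by linarith
    exact_mod_cast this
  rw [Complex.exp_eq_exp_iff_exists_int]
  exact ⟨-k, by rw [hk']; push_cast; ring⟩

/-- The theta series `∑ exp (π * I * (n ^ 2 + n) * τ)`, folded to a sum over `ℕ`. -/
lemma hasSum_jacobiTheta₂_half_period {τ : ℂ} (hτ : 0 < τ.im) :
    HasSum (fun n : ℕ => 2 * Complex.exp (π * Complex.I * (n ^ 2 + n) * τ))
      (jacobiTheta₂ (τ / 2) τ) := by
  refine (hasSum_jacobiTheta₂_term (τ / 2) hτ).nat_add_neg_add_one.congr_fun fun n => ?_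
  rw [jacobiTheta₂_term, jacobiTheta₂_term, two_mul]
  congr 2 <;> push_cast <;> ring

lemma norm_jacobiTheta₂_half_period_sub_two_le {τ : ℂ} (hτ : 0 < τ.im) :
    ‖jacobiTheta₂ (τ / 2) τ - 2‖ ≤ 2 * rexp (-2 * π * τ.im) / (1 - rexp (-2 * π * τ.im)) := by
  have h := (hasSum_nat_add_iff' 1).2 (hasSum_jacobiTheta₂_half_period hτ)
  set q := rexp (-2 * π * τ.im) with hq
  have hq1 : q < 1 := by rw [hq, Real.exp_lt_one_iff]; nlinarith [pi_pos]
  have hg : HasSum (fun n : ℕ => 2 * q * q ^ n) (2 * q / (1 - q)) :=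
    (hasSum_geometric_of_lt_one (exp_pos _).le hq1).mul_left _
  simp only [Finset.range_one, Finset.sum_singleton, Nat.cast_zero, ne_eq, OfNat.ofNat_ne_zero,
    not_false_eq_true, zero_pow, add_zero, mul_zero, zero_mul, Complex.exp_zero, mul_one] at h
  rw [← h.tsum_eq]
  refine tsum_of_norm_bounded hg fun n => ?_
  rw [norm_mul, Complex.norm_exp, Complex.norm_ofNat, mul_assoc 2 q, ← pow_succ', hq,
    ← Real.exp_nat_mul]
  gcongr
  have e : (π * Complex.I * (((n + 1 : ℕ) : ℂ) ^ 2 + (n + 1 : ℕ)) * τ).re =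
      -(π * τ.im * (((n : ℝ) + 1) ^ 2 + (n + 1))) := by
    rw [show (π * Complex.I * (((n + 1 : ℕ) : ℂ) ^ 2 + (n + 1 : ℕ)) * τ) =
      ((π * (((n : ℝ) + 1) ^ 2 + (n + 1)) : ℝ) : ℂ) * (Complex.I * τ) by push_cast; ring,
      Complex.re_ofReal_mul, Complex.I_mul_re]
    ring
  rw [e]
  push_cast
  have := mul_pos pi_pos hτ
  have hn : (0 : ℝ) ≤ n := n.cast_nonneg
  nlinarith [mul_nonneg this.le (mul_nonneg hn (by positivity : (0 : ℝ) ≤ n + 1))]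

/-- The inversion formula relating the alternating theta function at `τ` to the
half-period theta function at `-1 / τ`. -/
lemma jacobiTheta_add_one_eq (τ : ℂ) : jacobiTheta (τ + 1) = 1 / (-Complex.I * τ) ^ (1 / 2 : ℂ) *
    Complex.exp (π * Complex.I * (-1 / τ) / 4) * jacobiTheta₂ ((-1 / τ) / 2) (-1 / τ) := by
  rw [← jacobiTheta₂_half_eq, jacobiTheta₂_functional_equation, ← jacobiTheta₂_neg_left]
  congr 2
  · congr 1
    ring
  · ring

lemma jacobiTheta₂_half_period_add_one {τ : ℂ} (hτ : 0 < τ.im) :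
    jacobiTheta₂ ((τ + 1) / 2) (τ + 1) = jacobiTheta₂ (τ / 2) τ := by
  rw [← (hasSum_jacobiTheta₂_half_period hτ).tsum_eq,
    ← (hasSum_jacobiTheta₂_half_period (τ := τ + 1) (by simpa using hτ)).tsum_eq]
  refine tsum_congr fun n => ?_
  congr 1
  obtain ⟨k, hk⟩ : Even (n ^ 2 + n) := by
    rw [pow_two, ← Nat.mul_succ]
    exact Nat.even_mul_succ_self n
  have hk' : (n : ℂ) ^ 2 + n = k + k := by exact_mod_cast hk
  rw [Complex.exp_eq_exp_iff_exists_int]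
  exact ⟨k, by rw [hk']; push_cast; ring⟩

/-- The weights `‖θ_j‖ ^ 4 * Im` of the three theta constants, indexed by the nonzero vectors
modulo `2` in such a way that the modular group permutes them by right multiplication. -/
noncomputable def thetaWeight (v : Fin 2 → ZMod 2) (τ : UpperHalfPlane) : ℝ :=
  τ.im * if v 0 = 0 then
      if v 1 = 0 then 0 else ‖jacobiTheta₂ (τ / 2) τ‖ ^ 4 * rexp (-π * τ.im)
    else if v 1 = 0 then ‖jacobiTheta (τ + 1)‖ ^ 4 else ‖jacobiTheta τ‖ ^ 4

open ModularGroup Matrix in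
lemma thetaWeight_T_smul (v : Fin 2 → ZMod 2) (τ : UpperHalfPlane) :
    thetaWeight v (T • τ) =
      thetaWeight (v ᵥ* T.1.map (Int.castRingHom (ZMod 2))) τ := by
  have hc : ((T • τ : UpperHalfPlane) : ℂ) = τ + 1 := by
    rw [UpperHalfPlane.modular_T_smul, UpperHalfPlane.coe_vadd, add_comm, Complex.ofReal_one]
  have him : (T • τ : UpperHalfPlane).im = τ.im := by
    rw [UpperHalfPlane.modular_T_smul, UpperHalfPlane.vadd_im]
  have h3 : jacobiTheta (τ + 1 + 1) = jacobiTheta τ := by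
    rw [add_assoc, one_add_one_eq_two, add_comm, jacobiTheta_two_add]
  have hv : v ᵥ* T.1.map (Int.castRingHom (ZMod 2)) = ![v 0, v 0 + v 1] := by
    ext i
    fin_cases i <;> simp [T, vecMul, dotProduct, Fin.sum_univ_two]
  rw [hv]
  obtain ⟨a, b, rfl⟩ : ∃ a b, v = ![a, b] := ⟨v 0, v 1, by ext i; fin_cases i <;> rfl⟩
  simp only [thetaWeight, hc, him, h3, jacobiTheta₂_half_period_add_one τ.im_pos]
  have h11 : (1 + 1 : ZMod 2) = 0 := rfl
  have hd : ∀ a : ZMod 2, a = 0 ∨ a = 1 := by decide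
  rcases hd a with rfl | rfl <;> rcases hd b with rfl | rfl <;> simp [h11]

open ModularGroup Matrix in
lemma thetaWeight_S_smul (v : Fin 2 → ZMod 2) (τ : UpperHalfPlane) :
    thetaWeight v (S • τ) =
      thetaWeight (v ᵥ* S.1.map (Int.castRingHom (ZMod 2))) τ := by
  have hc (τ : UpperHalfPlane) : ((S • τ : UpperHalfPlane) : ℂ) = -1 / τ := by
    rw [UpperHalfPlane.modular_S_smul, UpperHalfPlane.coe_mk, ← neg_inv, neg_div, one_div]
  have him (τ : UpperHalfPlane) : (S • τ : UpperHalfPlane).im = τ.im / ‖(τ : ℂ)‖ ^ 2 := by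
    rw [← UpperHalfPlane.coe_im, hc, ← Complex.normSq_eq_norm_sq, neg_div, one_div,
      Complex.neg_im, Complex.inv_im, UpperHalfPlane.coe_im]
    ring
  have hpos (τ : UpperHalfPlane) : 0 < ‖(τ : ℂ)‖ := norm_pos_iff.2 τ.ne_zero
  have hnorm (τ : UpperHalfPlane) : ‖(-Complex.I * τ) ^ (1 / 2 : ℂ)‖ ^ 4 = ‖(τ : ℂ)‖ ^ 2 := by
    rw [show (1 / 2 : ℂ) = ((1 / 2 : ℝ) : ℂ) by push_cast; ring, Complex.norm_cpow_real,
      norm_mul, norm_neg, Complex.norm_I, one_mul, ← Real.rpow_mul_natCast (norm_nonneg _),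
      ← Real.rpow_natCast]
    norm_num
  have key (τ : UpperHalfPlane) : thetaWeight ![1, 0] τ = thetaWeight ![0, 1] (S • τ) := by
    have h := hpos τ
    simp only [thetaWeight, him, hc, jacobiTheta_add_one_eq τ, norm_mul, mul_pow, norm_div,
      norm_one, div_pow, one_pow, hnorm, Complex.norm_exp, ← Real.exp_nat_mul]
    have e : (π * Complex.I * (-1 / (τ : ℂ)) / 4).re = -π * (τ.im / ‖(τ : ℂ)‖ ^ 2) / 4 := by
      rw [← him, ← UpperHalfPlane.coe_im, hc]
      simp
    rw [e]
    simp
    field_simp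
  have key3 : thetaWeight ![1, 1] (S • τ) = thetaWeight ![1, 1] τ := by
    have h := hpos τ
    simp only [thetaWeight, him, jacobiTheta_S_smul, norm_mul, mul_pow, hnorm]
    simp
    field_simp
  have hv : v ᵥ* S.1.map (Int.castRingHom (ZMod 2)) = ![v 1, v 0] := by
    ext i
    fin_cases i <;> simp [S, vecMul, dotProduct, Fin.sum_univ_two, ZMod.neg_eq_self_mod_two]
  rw [hv]
  obtain ⟨a, b, rfl⟩ : ∃ a b, v = ![a, b] := ⟨v 0, v 1, by ext i; fin_cases i <;> rfl⟩
  have hSS : S • S • τ = τ := by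
    apply UpperHalfPlane.ext
    rw [hc, hc]
    field_simp
  have hd : ∀ a : ZMod 2, a = 0 ∨ a = 1 := by decide
  rcases hd a with rfl | rfl <;> rcases hd b with rfl | rfl
  · simp [thetaWeight]
  · exact (key τ).symm
  · exact (key _).trans (by rw [hSS]; rfl)
  · exact key3

open ModularGroup Matrix in
lemma thetaWeight_smul (γ : SpecialLinearGroup (Fin 2) ℤ) (v : Fin 2 → ZMod 2)
    (τ : UpperHalfPlane) : thetaWeight v (γ • τ) =
      thetaWeight (v ᵥ* γ.1.map (Int.castRingHom (ZMod 2))) τ := by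
  have hγ : γ ∈ Subgroup.closure {S, T} := by simp [SpecialLinearGroup.SL2Z_generators]
  induction hγ using Subgroup.closure_induction generalizing v τ with
  | one => simp
  | mem g hg =>
    rcases hg with rfl | rfl
    · exact thetaWeight_S_smul v τ
    · exact thetaWeight_T_smul v τ
  | mul g h _ _ ig ih =>
    rw [mul_smul, ig, ih, vecMul_vecMul, ← Matrix.map_mul]
    rfl
  | inv g _ ig =>
    have := ig (v ᵥ* g⁻¹.1.map (Int.castRingHom (ZMod 2))) (g⁻¹ • τ)
    rw [smul_inv_smul, vecMul_vecMul, ← Matrix.map_mul,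
      show g⁻¹.1 * g.1 = 1 from congrArg Subtype.val (inv_mul_cancel g),
      Matrix.map_one _ (map_zero _) (map_one _), vecMul_one] at this
    exact this.symm

lemma exp_neg_pi_mul_le {y : ℝ} (hy : 3 ≤ 4 * y ^ 2) (hy0 : 0 < y) : rexp (-π * y) ≤ 0.072 := by
  have hy1 : 0.86 ≤ y := by nlinarith
  have h1 : rexp (-π * y) ≤ rexp (-2.7) := exp_le_exp.2 (by nlinarith [pi_gt_d2])
  have h2 : 0.7 ≤ rexp (-0.3) := by linarith [add_one_le_exp (-0.3)]
  have h3 : rexp 3 = rexp 1 ^ 3 := by rw [← Real.exp_nat_mul]; norm_num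
  have h4 : 20 ≤ rexp 3 := by
    rw [h3]
    calc (20 : ℝ) ≤ 2.7182818283 ^ 3 := by norm_num
      _ ≤ _ := by gcongr; exact exp_one_gt_d9.le
  have h5 : rexp (-2.7) * (rexp (-0.3) * rexp 3) = 1 := by
    rw [← Real.exp_add, ← Real.exp_add]; norm_num
  nlinarith [exp_pos (-2.7), mul_le_mul h2 h4 (by norm_num) (exp_pos _).le]

lemma norm_jacobiTheta_ge {τ : ℂ} (hτ : 3 ≤ 4 * τ.im ^ 2) (hτ0 : 0 < τ.im) :
    0.84 ≤ ‖jacobiTheta τ‖ := by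
  have h := norm_jacobiTheta_sub_one_le hτ0
  have hx := exp_neg_pi_mul_le hτ hτ0
  have h0 := exp_pos (-π * τ.im)
  have : 2 / (1 - rexp (-π * τ.im)) * rexp (-π * τ.im) ≤ 0.16 := by
    rw [div_mul_eq_mul_div, div_le_iff₀ (by linarith)]
    linarith
  have h1 := norm_sub_norm_le (1 : ℂ) (1 - jacobiTheta τ)
  rw [sub_sub_cancel, norm_one, norm_sub_rev] at h1
  linarith

lemma norm_jacobiTheta₂_half_period_ge {τ : ℂ} (hτ : 3 ≤ 4 * τ.im ^ 2) (hτ0 : 0 < τ.im) :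
    1.98 ≤ ‖jacobiTheta₂ (τ / 2) τ‖ := by
  have h := norm_jacobiTheta₂_half_period_sub_two_le hτ0
  have hx := exp_neg_pi_mul_le hτ hτ0
  have h0 := exp_pos (-π * τ.im)
  have h2 : rexp (-2 * π * τ.im) = rexp (-π * τ.im) ^ 2 := by
    rw [← Real.exp_nat_mul]
    congr 1
    push_cast
    ring
  have h3 : rexp (-2 * π * τ.im) ≤ 0.0052 := by
    rw [h2]
    nlinarith
  have : 2 * rexp (-2 * π * τ.im) / (1 - rexp (-2 * π * τ.im)) ≤ 0.02 := by
    rw [div_le_iff₀ (by linarith)]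
    linarith
  have h1 := norm_sub_norm_le (2 : ℂ) (2 - jacobiTheta₂ (τ / 2) τ)
  rw [sub_sub_cancel, Complex.norm_ofNat, norm_sub_rev] at h1
  linarith

lemma thetaWeight_ge {τ : UpperHalfPlane} (hτ : 3 ≤ 4 * τ.im ^ 2) {v : Fin 2 → ZMod 2}
    (hv : v 0 ≠ 0) : 0.42 ≤ thetaWeight v τ := by
  have hy1 : 0.86 ≤ τ.im := by nlinarith [τ.im_pos]
  have h (τ' : ℂ) (e : τ'.im = τ.im) : 0.42 ≤ τ.im * ‖jacobiTheta τ'‖ ^ 4 :=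
    calc (0.42 : ℝ) ≤ 0.86 * 0.84 ^ 4 := by norm_num
      _ ≤ _ := by
        gcongr
        exact norm_jacobiTheta_ge (by rwa [e]) (by rw [e]; exact τ.im_pos)
  rw [thetaWeight, if_neg hv]
  split_ifs
  · exact h _ (by simp)
  · exact h _ (by simp)

lemma thetaWeight_ge' {τ : UpperHalfPlane} (hτ : 3 ≤ 4 * τ.im ^ 2) {v : Fin 2 → ZMod 2}
    (hv : v 0 = 0) (hv1 : v 1 ≠ 0) : 15 * (τ.im * rexp (-π * τ.im)) ≤ thetaWeight v τ := by
  have h : (15 : ℝ) ≤ ‖jacobiTheta₂ (τ / 2) τ‖ ^ 4 :=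
    calc (15 : ℝ) ≤ 1.98 ^ 4 := by norm_num
      _ ≤ _ := by
        gcongr
        exact norm_jacobiTheta₂_half_period_ge hτ τ.im_pos
  rw [thetaWeight, if_pos hv, if_neg hv1]
  have := mul_le_mul_of_nonneg_left h (mul_pos τ.im_pos (exp_pos (-π * τ.im))).le
  linarith

open Matrix in
/-- Reduction of a point of the upper half plane to the fundamental domain, keeping track of the
alternating theta function. -/
lemma exists_thetaWeight_eq (τ : UpperHalfPlane) :
    ∃ (γ : SpecialLinearGroup (Fin 2) ℤ) (v : Fin 2 → ZMod 2), 3 ≤ 4 * (γ • τ).im ^ 2 ∧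
      thetaWeight ![1, 0] τ = thetaWeight v (γ • τ) ∧ v 0 = γ 1 1 ∧ (v 0 = 0 → v 1 ≠ 0 ∧
        (γ 1 0 : ZMod 2) ≠ 0) := by
  obtain ⟨γ, hγ⟩ := ModularGroup.exists_smul_mem_fd τ
  have h := thetaWeight_smul γ⁻¹ ![1, 0] (γ • τ)
  rw [inv_smul_smul] at h
  have hv : ![1, 0] ᵥ* γ⁻¹.1.map (Int.castRingHom (ZMod 2)) =
      ![(γ 1 1 : ZMod 2), -(γ 0 1 : ZMod 2)] := by
    ext i
    fin_cases i <;> simp [vecMul, dotProduct, Fin.sum_univ_two, adjugate_fin_two]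
  refine ⟨γ, _, ModularGroup.three_le_four_mul_im_sq_of_mem_fd hγ, h, by rw [hv]; rfl, ?_⟩
  rw [hv]
  intro h0
  have hdet : (γ 0 0 : ZMod 2) * γ 1 1 - γ 0 1 * γ 1 0 = 1 := by
    have := γ.det_coe
    rw [det_fin_two] at this
    exact_mod_cast congrArg (Int.cast : ℤ → ZMod 2) this
  simp only [cons_val_zero] at h0
  rw [h0] at hdet
  constructor
  · intro h1
    simp only [cons_val_one, cons_val_fin_one, neg_eq_zero] at h1
    simp [h1] at hdet
  · intro h1
    simp [h1] at hdet

lemma thetaWeight_alternating (τ : UpperHalfPlane) :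
    thetaWeight ![1, 0] τ = τ.im * ‖jacobiTheta (τ + 1)‖ ^ 4 := by
  simp [thetaWeight]

/-- The alternating theta function has no zeros. -/
lemma jacobiTheta_add_one_ne_zero {τ : ℂ} (hτ : 0 < τ.im) : jacobiTheta (τ + 1) ≠ 0 := by
  obtain ⟨γ, v, h3, hw, -, hv⟩ := exists_thetaWeight_eq ⟨τ, hτ⟩
  intro h0
  have hw0 : thetaWeight ![1, 0] ⟨τ, hτ⟩ = 0 := by
    rw [thetaWeight_alternating]
    simp [h0]
  rw [hw0] at hw
  by_cases hv0 : v 0 = 0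
  · have := thetaWeight_ge' h3 hv0 (hv hv0).1
    have := mul_pos (γ • (⟨τ, hτ⟩ : UpperHalfPlane)).im_pos (exp_pos
      (-π * (γ • (⟨τ, hτ⟩ : UpperHalfPlane)).im))
    linarith
  · have := thetaWeight_ge h3 hv0
    linarith

lemma nine_mul_sq_le {x y : ℝ} (hy : 0 < y) (hy' : y ≤ 1 / 36) (hx : |x| ≤ 1)
    (hxy : y < x ^ 2 + y ^ 2) {c d : ℤ} (hc : ¬ ((2 : ℕ) : ℤ) ∣ c) (hd : ((2 : ℕ) : ℤ) ∣ d) :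
    9 * y ^ 2 ≤ ((d : ℝ) - c * x) ^ 2 + (c : ℝ) ^ 2 * y ^ 2 := by
  obtain ⟨hx1, hx2⟩ := abs_le.1 hx
  rcases lt_or_ge 1 |c| with hc1 | hc1
  · have h3 : 3 ≤ |c| := by
      rcases abs_cases (c) with h | h <;> omega
    have h9 : (9 : ℝ) ≤ (c : ℝ) ^ 2 := by
      rw [← sq_abs]
      have : (3 : ℝ) ≤ |(c : ℝ)| := by exact_mod_cast h3
      nlinarith
    nlinarith [sq_nonneg ((d : ℝ) - c * x), sq_nonneg y]
  · have hc2 : c = 1 ∨ c = -1 := by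
      rw [abs_le] at hc1
      omega
    have hc3 : (c : ℝ) ^ 2 = 1 := by
      rcases hc2 with h | h <;> simp [h]
    by_cases hd0 : d = 0
    · have e : ((d : ℝ) - c * x) ^ 2 + (c : ℝ) ^ 2 * y ^ 2 = x ^ 2 + y ^ 2 := by
        rw [hd0, Int.cast_zero, zero_sub, neg_sq, mul_pow, hc3]
        ring
      rw [e]
      nlinarith
    · have hd2 : (4 : ℝ) ≤ (d : ℝ) ^ 2 := by
        have : 2 ≤ |d| := by
          rcases abs_cases (d) with h | h <;> omega
        rw [← sq_abs]
        have : (2 : ℝ) ≤ |(d : ℝ)| := by exact_mod_cast this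
        nlinarith
      have hcx : |(c : ℝ) * x| ≤ 1 := by
        rcases hc2 with h | h <;> simpa [h] using hx
      have h1 : 1 ≤ ((d : ℝ) - c * x) ^ 2 := by
        have h2 : 2 ≤ |(d : ℝ)| := by
          nlinarith [sq_abs (d : ℝ), abs_nonneg (d : ℝ)]
        have h3 := abs_sub_abs_le_abs_sub (d : ℝ) (c * x)
        rw [← sq_abs]
        nlinarith
      nlinarith [sq_nonneg ((c : ℝ) * y)]

lemma one_le_of_mul_exp_le {y Y N : ℝ} (hy : 0 < y) (hy' : y ≤ 1 / 36) (hY1 : 0.86 ≤ Y)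
    (hYle : Y ≤ 1 / (9 * y)) (hN : 0 ≤ N) (hge : 15 * (Y * rexp (-π * Y)) ≤ y * N) :
    1 ≤ 0.15 ^ 4 * rexp (π / (9 * y)) * N := by
  have hB : 1 / (9 * y) - Y + Y ≤ Y * rexp (π * (1 / (9 * y) - Y)) := by
    have h1 := add_one_le_exp (π * (1 / (9 * y) - Y))
    have h2 : 1 ≤ Y * π := by nlinarith [pi_gt_three]
    have h3 := mul_le_mul_of_nonneg_left h1 (by linarith : 0 ≤ Y)
    nlinarith [mul_nonneg (sub_nonneg.2 h2) (sub_nonneg.2 hYle)]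
  have e : π * (1 / (9 * y) - Y) = π / (9 * y) + -π * Y := by ring
  rw [e, Real.exp_add, sub_add_cancel, div_le_iff₀ (by positivity)] at hB
  have hE := exp_pos (π / (9 * y))
  set E := rexp (π / (9 * y))
  have hEN : 15 ≤ 9 * y ^ 2 * (E * N) := by
    have := mul_le_mul_of_nonneg_left hge (by positivity : 0 ≤ E * (9 * y))
    nlinarith
  have hEN0 : 0 ≤ E * N := by positivity
  have hyy : y ^ 2 ≤ 1 / 1296 := by nlinarith
  nlinarith [mul_le_mul_of_nonneg_right hyy hEN0]

/-- Away from the cusp `0`, the reciprocal of the alternating theta function is small compared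
with its size at that cusp. -/
lemma norm_inv_jacobiTheta_le {s : ℂ} (hs : 0 < s.re) (hs' : s.re ≤ 1 / 36) (hx : |s.im| ≤ 1)
    (hcusp : s.re < Complex.normSq s) :
    ‖(jacobiTheta (Complex.I * s + 1))⁻¹‖ ≤ 0.15 * rexp (π / (36 * s.re)) := by
  have hτ : 0 < (Complex.I * s).im := by simpa using hs
  set τ : UpperHalfPlane := ⟨Complex.I * s, hτ⟩ with hτdef
  have him : τ.im = s.re := by simp [← UpperHalfPlane.coe_im, hτdef]
  obtain ⟨γ, v, h3, hw, hv0, hv⟩ := exists_thetaWeight_eq τ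
  rw [thetaWeight_alternating, him] at hw
  change s.re * ‖jacobiTheta (Complex.I * s + 1)‖ ^ 4 = _ at hw
  have hN : 0 < ‖jacobiTheta (Complex.I * s + 1)‖ := norm_pos_iff.2 (jacobiTheta_add_one_ne_zero hτ)
  rw [norm_inv, inv_le_iff_one_le_mul₀ hN]
  refine (one_le_pow_iff_of_nonneg (by positivity) four_ne_zero).1 ?_
  rw [mul_pow, mul_pow, ← Real.exp_nat_mul]
  have hexp : ((4 : ℕ) : ℝ) * (π / (36 * s.re)) = π / (9 * s.re) := by
    field_simp
    norm_num
  rw [hexp]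
  set y := s.re with hy
  set Y := (γ • τ).im with hY
  have hY1 : 0.86 ≤ Y := by nlinarith [(γ • τ).im_pos]
  by_cases h0 : v 0 = 0
  · have hge := thetaWeight_ge' h3 h0 (hv h0).1
    rw [← hw] at hge
    have hYle : Y ≤ 1 / (9 * y) := by
      rw [hv0] at h0
      have hc := (hv (hv0.trans h0)).2
      rw [ne_eq, ZMod.intCast_zmod_eq_zero_iff_dvd] at hc
      rw [ZMod.intCast_zmod_eq_zero_iff_dvd] at h0
      have hD : Complex.normSq (UpperHalfPlane.denom γ τ) =
          ((γ 1 1 : ℝ) - γ 1 0 * s.im) ^ 2 + (γ 1 0 : ℝ) ^ 2 * y ^ 2 := by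
        rw [ModularGroup.denom_apply, Complex.normSq_apply]
        simp [hτdef, ← hy]
        ring
      have hYD : Y = y / Complex.normSq (UpperHalfPlane.denom γ τ) := by
        rw [hY, ModularGroup.im_smul_eq_div_normSq, him]
      have hDpos : 0 < Complex.normSq (UpperHalfPlane.denom γ τ) := UpperHalfPlane.normSq_denom_pos _ τ.im_ne_zero
      suffices 9 * y ^ 2 ≤ Complex.normSq (UpperHalfPlane.denom γ τ) by
        rw [hYD, div_le_div_iff₀ hDpos (by positivity)]
        linarith
      rw [hD]
      refine nine_mul_sq_le hs hs' hx ?_ hc h0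
      rwa [Complex.normSq_apply, ← pow_two, ← pow_two, add_comm] at hcusp
    exact one_le_of_mul_exp_le hs hs' hY1 hYle (by positivity) hge
  · have hge := thetaWeight_ge h3 h0
    rw [← hw] at hge
    have h1 : rexp 12 ≤ rexp (π / (9 * y)) := by
      rw [exp_le_exp, le_div_iff₀ (by positivity)]
      nlinarith [pi_gt_three]
    have h2 : (132 : ℝ) ≤ rexp 12 := by
      have h3 : rexp 12 = rexp 1 ^ 12 := by rw [← Real.exp_nat_mul]; norm_num
      rw [h3]
      calc (132 : ℝ) ≤ 2.7 ^ 12 := by norm_num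
        _ ≤ _ := by gcongr; linarith [exp_one_gt_d9]
    have h3 : 0.42 * 36 ≤ ‖jacobiTheta (Complex.I * s + 1)‖ ^ 4 := by
      have h0 : 0 ≤ ‖jacobiTheta (Complex.I * s + 1)‖ ^ 4 := by positivity
      nlinarith
    calc (1 : ℝ) ≤ 0.15 ^ 4 * 132 * (0.42 * 36) := by norm_num
      _ ≤ _ := by gcongr; exact h2.trans h1

/-- Near the cusp `0`, the reciprocal of the alternating theta function is close to its leading
term. -/
lemma norm_inv_jacobiTheta_sub_le_one {s : ℂ} (hs : 0 < s.re) (hs' : s.re ≤ 1)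
    (hcusp : Complex.normSq s ≤ s.re) :
    ‖(jacobiTheta (Complex.I * s + 1))⁻¹ -
      1 / 2 * s ^ (1 / 2 : ℂ) * Complex.exp (π / (4 * s))‖ ≤ 1 := by
  have hs0 : s ≠ 0 := fun h => by simp [h] at hs
  have hn : 0 < Complex.normSq s := Complex.normSq_pos.2 hs0
  have hu0 : s ^ (1 / 2 : ℂ) ≠ 0 := by simp [Complex.cpow_eq_zero_iff, hs0]
  have hu : ‖s ^ (1 / 2 : ℂ)‖ ≤ 1 := by
    rw [show (1 / 2 : ℂ) = ((1 / 2 : ℝ) : ℂ) by push_cast; ring, Complex.norm_cpow_real]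
    refine Real.rpow_le_one (norm_nonneg _) ?_ (by norm_num)
    rw [Complex.normSq_eq_norm_sq] at hcusp
    nlinarith [norm_nonneg s]
  have hτ' : -1 / (Complex.I * s) = Complex.I / s := by
    field_simp
    rw [Complex.I_sq]
  set Y := s.re / Complex.normSq s with hY
  have hY1 : 1 ≤ Y := (one_le_div hn).2 hcusp
  have him : (Complex.I / s).im = Y := by
    rw [Complex.div_im]
    simp [hY]
  have hJ := norm_jacobiTheta₂_half_period_sub_two_le (τ := Complex.I / s) (by rw [him]; linarith)
  have hJ0 := norm_jacobiTheta₂_half_period_ge (τ := Complex.I / s) (by rw [him]; nlinarith)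
    (by rw [him]; linarith)
  rw [him] at hJ
  have hθ := jacobiTheta_add_one_eq (Complex.I * s)
  rw [hτ'] at hθ
  rw [show -Complex.I * (Complex.I * s) = s by linear_combination -s * Complex.I_sq,
    show π * Complex.I * (Complex.I / s) / 4 = -(π / (4 * s)) by
      field_simp; linear_combination Complex.I_sq, Complex.exp_neg] at hθ
  set J := jacobiTheta₂ (Complex.I / s / 2) (Complex.I / s)
  have hJne : J ≠ 0 := norm_pos_iff.1 (by linarith)
  have e : (jacobiTheta (Complex.I * s + 1))⁻¹ - 1 / 2 * s ^ (1 / 2 : ℂ) *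
      Complex.exp (π / (4 * s)) =
      s ^ (1 / 2 : ℂ) * Complex.exp (π / (4 * s)) * (-(J - 2) / (2 * J)) := by
    rw [hθ]
    have := Complex.exp_ne_zero (π / (4 * s))
    field_simp
    ring
  have hE : ‖Complex.exp (π / (4 * s))‖ = rexp (π * Y / 4) := by
    rw [Complex.norm_exp]
    congr 1
    rw [show (π : ℂ) / (4 * s) = ((π / 4 : ℝ) : ℂ) * s⁻¹ by push_cast; field_simp,
      Complex.re_ofReal_mul, Complex.inv_re]
    ring
  have hhalf {t : ℝ} (ht : 1 ≤ t) : rexp (-t) ≤ 1 / 2 := by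
    rw [Real.exp_neg, one_div]
    gcongr
    linarith [add_one_le_exp t]
  have hq : rexp (-2 * π * Y) ≤ 1 / 2 := by
    rw [show -2 * π * Y = -(2 * π * Y) by ring]
    exact hhalf (by nlinarith [pi_gt_three])
  have hJ2 : ‖J - 2‖ ≤ 2 * (rexp (-2 * π * Y) * 2) := by
    refine hJ.trans ?_
    rw [div_le_iff₀ (by linarith)]
    nlinarith [exp_pos (-2 * π * Y)]
  have hEq : rexp (π * Y / 4) * rexp (-2 * π * Y) ≤ 1 / 2 := by
    rw [← Real.exp_add, show π * Y / 4 + -2 * π * Y = -(7 / 4 * π * Y) by ring]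
    exact hhalf (by nlinarith [pi_gt_three])
  rw [e, norm_mul, norm_mul, hE, norm_div, norm_neg, norm_mul, Complex.norm_ofNat]
  calc ‖s ^ (1 / 2 : ℂ)‖ * rexp (π * Y / 4) * (‖J - 2‖ / (2 * ‖J‖))
      ≤ 1 * rexp (π * Y / 4) * (2 * (rexp (-2 * π * Y) * 2) / (2 * 1)) := by
        gcongr
        linarith
    _ = 2 * (rexp (π * Y / 4) * rexp (-2 * π * Y)) := by ring
    _ ≤ 1 := by linarith

lemma norm_inv_jacobiTheta_sub_le {s : ℂ} (hs : 0 < s.re) (hs' : s.re ≤ 1 / 36)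
    (hx : |s.im| ≤ 1) :
    ‖(jacobiTheta (Complex.I * s + 1))⁻¹ -
      1 / 2 * s ^ (1 / 2 : ℂ) * Complex.exp (π / (4 * s))‖ ≤
      0.15 * rexp (π / (36 * s.re)) + 1.2 := by
  have hexp := exp_pos (π / (36 * s.re))
  rcases le_or_gt (Complex.normSq s) s.re with h | h
  · have := norm_inv_jacobiTheta_sub_le_one hs (by linarith) h
    linarith
  refine (norm_sub_le _ _).trans (add_le_add (norm_inv_jacobiTheta_le hs hs' hx h) ?_)
  have hn : 0 < Complex.normSq s := hs.trans h
  have hE : ‖Complex.exp (π / (4 * s))‖ ≤ 2.25 := by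
    rw [Complex.norm_exp, show (π : ℂ) / (4 * s) = ((π / 4 : ℝ) : ℂ) * s⁻¹ by
      push_cast; ring, Complex.re_ofReal_mul, Complex.inv_re]
    have h1 : s.re / Complex.normSq s ≤ 1 := (div_le_one hn).2 h.le
    have h2 : π / 4 * (s.re / Complex.normSq s) ≤ 0.79 := by
      nlinarith [pi_lt_d2, pi_pos, div_pos hs hn]
    refine (exp_le_exp.2 h2).trans ?_
    have h3 : rexp 0.79 * rexp 0.21 = rexp 1 := by rw [← Real.exp_add]; norm_num
    nlinarith [add_one_le_exp (0.21 : ℝ), exp_one_lt_d9, exp_pos 0.79]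
  have hu : ‖s ^ (1 / 2 : ℂ)‖ ≤ 1.03 := by
    rw [show (1 / 2 : ℂ) = ((1 / 2 : ℝ) : ℂ) by push_cast; ring, Complex.norm_cpow_real]
    have h1 : ‖s‖ ≤ 1.03 := (Complex.norm_le_abs_re_add_abs_im s).trans (by
      rw [abs_of_pos hs]; linarith)
    calc ‖s‖ ^ (1 / 2 : ℝ) ≤ 1.03 ^ (1 / 2 : ℝ) := by gcongr
      _ ≤ 1.03 ^ (1 : ℝ) := by
        apply Real.rpow_le_rpow_of_exponent_le <;> norm_num
      _ = 1.03 := Real.rpow_one _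
  rw [norm_mul, norm_mul, norm_div, norm_one, Complex.norm_ofNat]
  have := mul_le_mul hu hE (norm_nonneg _) (by norm_num)
  linarith

/-- The overpartition numbers are given by a single Bessel-type integral, up to the contribution
of the circle away from the dominant cusp. -/
lemma norm_pbar_sub_integral_le (n : ℕ) {y : ℝ} (hy : 0 < y) (hy' : y ≤ 1 / 36) :
    ‖(pbar n : ℂ) - 1 / 4 * ∫ x in (-1 : ℝ)..1, ((y : ℂ) + x * Complex.I) ^ (1 / 2 : ℂ) *
      Complex.exp (π / 4 / (y + x * Complex.I) + π * n * (y + x * Complex.I))‖ ≤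
      rexp (π * n * y) * (0.15 * rexp (π / (36 * y)) + 1.2) := by
  rw [pbar_eq_integral (fun τ hτ => jacobiTheta_add_one_ne_zero hτ) n hy,
    show (1 / 4 : ℂ) = 1 / 2 * (1 / 2) by norm_num, mul_assoc, ← mul_sub,
    ← intervalIntegral.integral_const_mul (1 / 2 : ℂ),
    ← intervalIntegral.integral_sub]
  · rw [norm_mul, norm_div, norm_one, Complex.norm_ofNat]
    have hb : ∀ x ∈ Set.uIoc (-1 : ℝ) 1,
        ‖Complex.exp (π * n * (y + x * Complex.I)) *
          (jacobiTheta (Complex.I * (y + x * Complex.I) + 1))⁻¹ -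
        1 / 2 * (((y : ℂ) + x * Complex.I) ^ (1 / 2 : ℂ) *
          Complex.exp (π / 4 / (y + x * Complex.I) + π * n * (y + x * Complex.I)))‖ ≤
        rexp (π * n * y) * (0.15 * rexp (π / (36 * y)) + 1.2) := by
      intro x hx
      rw [Set.uIoc_of_le (by norm_num)] at hx
      have h := norm_inv_jacobiTheta_sub_le (s := (y : ℂ) + x * Complex.I) (by simpa using hy)
        (by simpa using hy') (by simpa [abs_le] using ⟨hx.1.le, hx.2⟩)
      have e : (((y : ℂ) + x * Complex.I)).re = y := by simp
      rw [e] at h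
      have e2 : Complex.exp (π * n * (y + x * Complex.I)) *
            (jacobiTheta (Complex.I * (y + x * Complex.I) + 1))⁻¹ -
          1 / 2 * (((y : ℂ) + x * Complex.I) ^ (1 / 2 : ℂ) *
            Complex.exp (π / 4 / (y + x * Complex.I) + π * n * (y + x * Complex.I))) =
          Complex.exp (π * n * (y + x * Complex.I)) *
          ((jacobiTheta (Complex.I * (y + x * Complex.I) + 1))⁻¹ -
          1 / 2 * ((y : ℂ) + x * Complex.I) ^ (1 / 2 : ℂ) *
            Complex.exp (π / (4 * (y + x * Complex.I)))) := by
        rw [Complex.exp_add, div_div]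
        ring
      have e3 : ‖Complex.exp (π * n * (y + x * Complex.I))‖ = rexp (π * n * y) := by
        rw [Complex.norm_exp]
        congr 1
        simp
      rw [e2, norm_mul, e3]
      gcongr
    have := intervalIntegral.norm_integral_le_of_norm_le_const hb
    have e4 : |(1 : ℝ) - -1| = 2 := by norm_num
    rw [e4] at this
    linarith
  · refine ContinuousOn.intervalIntegrable fun x _ => ContinuousAt.continuousWithinAt ?_
    have hτ : 0 < (Complex.I * (y + x * Complex.I) + 1).im := by simpa using hy
    refine ContinuousAt.mul (by fun_prop) (ContinuousAt.inv₀ ?_ (jacobiTheta_add_one_ne_zero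
      (by simpa using hy)))
    exact (continuousAt_jacobiTheta hτ).comp
      (f := fun x : ℝ => Complex.I * ((y : ℂ) + x * Complex.I) + 1) (by fun_prop)
  · refine ContinuousOn.intervalIntegrable fun x _ => ContinuousAt.continuousWithinAt ?_
    have hs : (y : ℂ) + x * Complex.I ∈ Complex.slitPlane := Or.inl (by simpa using hy)
    have h0 : (y : ℂ) + x * Complex.I ≠ 0 := Complex.slitPlane_ne_zero hs
    refine continuousAt_const.mul (ContinuousAt.mul ?_ ?_)
    · exact ContinuousAt.cpow (by fun_prop) continuousAt_const hs
    · exact ContinuousAt.cexp (by fun_prop (disch := exact h0))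

/-- A primitive of `exp (-z ^ 2)` on the complex plane, with its limiting behaviour in the right
half plane. -/
lemma exists_gaussian_primitive : ∃ W : ℂ → ℂ, (∀ z, HasDerivAt W (Complex.exp (-z ^ 2)) z) ∧
    (∀ z, W (-z) = -W z) ∧
    ∀ z : ℂ, 0 ≤ z.re → ‖W z - √π / 2‖ ≤ √π / 2 * rexp (-(z ^ 2).re) := by
  have hdiff : Differentiable ℂ fun z : ℂ => Complex.exp (-z ^ 2) := by fun_prop
  obtain ⟨W, hW0, hW⟩ : ∃ W : ℂ → ℂ, W 0 = 0 ∧ ∀ z, HasDerivAt W (Complex.exp (-z ^ 2)) z := by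
    obtain ⟨W, hW⟩ := hdiff.isExactOn_univ
    refine ⟨fun z => W z - W 0, sub_self _, fun z => ?_⟩
    exact (hW z (Set.mem_univ z)).sub_const _
  have hodd : ∀ z, W (-z) = -W z := by
    intro z
    have h : ∀ z, HasDerivAt (fun z => W (-z) + W z) 0 z := by
      intro z
      exact (((hW (-z)).scomp z (hasDerivAt_neg z)).add (hW z)).congr_deriv (by simp)
    have := is_const_of_deriv_eq_zero (fun z => (h z).differentiableAt) (fun z => (h z).deriv) z 0
    simp only [neg_zero, hW0, add_zero] at this
    exact eq_neg_of_add_eq_zero_left this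
  have hW_int (z : ℂ) (T : ℝ) : W (z + T) - W z = ∫ t in (0 : ℝ)..T, Complex.exp (-(z + t) ^ 2) := by
    have h : ∀ t : ℝ, HasDerivAt (fun t : ℝ => W (z + t)) (Complex.exp (-(z + t) ^ 2)) t := by
      intro t
      exact ((hW (z + t)).scomp t ((hasDerivAt_id t).ofReal_comp.const_add z)).congr_deriv
        (by simp)
    rw [intervalIntegral.integral_eq_sub_of_hasDerivAt (fun t _ => h t)
      (Continuous.intervalIntegrable (by fun_prop) _ _)]
    simp
  have hreal : Filter.Tendsto (fun T : ℝ => W T) Filter.atTop (nhds (√π / 2)) := by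
    have hi : MeasureTheory.Integrable fun t : ℝ => rexp (-1 * t ^ 2) :=
      integrable_exp_neg_mul_sq one_pos
    have h1 := MeasureTheory.intervalIntegral_tendsto_integral_Ioi 0
      hi.integrableOn Filter.tendsto_id
    rw [integral_gaussian_Ioi, div_one] at h1
    have h2 := (Complex.continuous_ofReal.tendsto _).comp h1
    rw [Complex.ofReal_div, Complex.ofReal_ofNat] at h2
    refine h2.congr fun T => ?_
    have h3 := hW_int 0 T
    rw [zero_add, hW0, sub_zero] at h3
    simp only [h3, Function.comp_apply, id, zero_add]
    rw [← intervalIntegral.integral_ofReal]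
    simp
  have hshift (z : ℂ) : Filter.Tendsto (fun T : ℝ => W (z + T)) Filter.atTop (nhds (√π / 2)) := by
    have hb : ∀ T : ℝ, 0 ≤ T → ‖W (z + T) - W T‖ ≤
        rexp (-(T ^ 2 - 2 * T * ‖z‖ - ‖z‖ ^ 2)) * ‖z‖ := by
      intro T hT
      have hd : ∀ w ∈ Metric.closedBall (T : ℂ) ‖z‖, ‖Complex.exp (-w ^ 2)‖ ≤
          rexp (-(T ^ 2 - 2 * T * ‖z‖ - ‖z‖ ^ 2)) := by
        intro w hw
        rw [Metric.mem_closedBall, dist_eq_norm] at hw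
        rw [Complex.norm_exp, Real.exp_le_exp, Complex.neg_re, neg_le_neg_iff]
        have e : w ^ 2 = T ^ 2 + (2 * T * (w - T) + (w - T) ^ 2) := by ring
        have h1 : ‖2 * T * (w - T) + (w - T) ^ 2‖ ≤ 2 * T * ‖z‖ + ‖z‖ ^ 2 := by
          refine (norm_add_le _ _).trans ?_
          rw [norm_mul, norm_mul, norm_pow, Complex.norm_real, Real.norm_of_nonneg hT,
            Complex.norm_ofNat]
          gcongr
        have h2 := (abs_le.1 ((Complex.abs_re_le_norm _).trans h1)).1
        rw [e, Complex.add_re, ← Complex.ofReal_pow, Complex.ofReal_re]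
        linarith
      have h := (convex_closedBall (T : ℂ) ‖z‖).norm_image_sub_le_of_norm_hasDerivWithin_le
        (fun w _ => (hW w).hasDerivWithinAt) hd (Metric.mem_closedBall_self (norm_nonneg z))
        (y := z + T) (by simp [dist_eq_norm])
      simpa using h
    have hz : Filter.Tendsto (fun T : ℝ => rexp (-(T ^ 2 - 2 * T * ‖z‖ - ‖z‖ ^ 2)) * ‖z‖)
        Filter.atTop (nhds 0) := by
      rw [← zero_mul ‖z‖]
      refine Filter.Tendsto.mul_const _ (Real.tendsto_exp_atBot.comp
        (Filter.tendsto_neg_atTop_atBot.comp (Filter.tendsto_atTop_mono' _ (f₁ := id) ?_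
          Filter.tendsto_id)))
      filter_upwards [Filter.eventually_ge_atTop (1 + 2 * ‖z‖ + ‖z‖ ^ 2)] with T hT
      have h0 := norm_nonneg z
      simp only [id]
      nlinarith [mul_nonneg (show 0 ≤ T - (1 + 2 * ‖z‖ + ‖z‖ ^ 2) by linarith)
        (show 0 ≤ T - 1 by nlinarith), sq_nonneg ‖z‖]
    have h1 : Filter.Tendsto (fun T : ℝ => W (z + T) - W T) Filter.atTop (nhds 0) :=
      squeeze_zero_norm' (Filter.eventually_atTop.2 ⟨0, hb⟩) hz
    simpa using h1.add hreal
  refine ⟨W, hW, hodd, fun z hz => ?_⟩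
  have hlim : Filter.Tendsto (fun T : ℝ => ‖W z - W (z + T)‖) Filter.atTop
      (nhds ‖W z - √π / 2‖) := (tendsto_const_nhds.sub (hshift z)).norm
  refine le_of_tendsto hlim (Filter.eventually_atTop.2 ⟨0, fun T hT => ?_⟩)
  rw [norm_sub_rev, hW_int]
  have hi : IntervalIntegrable (fun t : ℝ => rexp (-(z ^ 2).re) * rexp (-1 * t ^ 2))
      MeasureTheory.volume 0 T := Continuous.intervalIntegrable (by fun_prop) _ _
  refine (intervalIntegral.norm_integral_le_of_norm_le hT ?_ hi).trans ?_
  · refine Filter.Eventually.of_forall fun t ht => ?_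
    have e : (-(z + t) ^ 2).re = -(z ^ 2).re + (-1 * t ^ 2 - 2 * z.re * t) := by
      simp [sq]; ring
    rw [Complex.norm_exp, ← Real.exp_add, Real.exp_le_exp, e]
    nlinarith [mul_nonneg hz ht.1.le]
  · rw [intervalIntegral.integral_const_mul, mul_comm]
    gcongr
    have h1 := integral_gaussian_Ioi 1
    rw [div_one] at h1
    rw [← h1, intervalIntegral.integral_of_le hT]
    exact MeasureTheory.setIntegral_mono_set (integrable_exp_neg_mul_sq one_pos).integrableOn
      (Filter.Eventually.of_forall fun t => (Real.exp_pos _).le)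
      (Set.Ioc_subset_Ioi_self).eventuallyLE

lemma cpow_half_re_pos {s : ℂ} (hs : 0 < s.re) : 0 < (s ^ (1 / 2 : ℂ)).re := by
  have hs0 : s ≠ 0 := fun h => by simp [h] at hs
  have harg := Complex.abs_arg_lt_pi_div_two_iff.2 (Or.inl hs)
  have him : (Complex.log s * (1 / 2)).im = s.arg / 2 := by
    rw [show (1 / 2 : ℂ) = ((1 / 2 : ℝ) : ℂ) by push_cast; ring, Complex.im_mul_ofReal,
      Complex.log_im]
    ring
  rw [Complex.cpow_def_of_ne_zero hs0, Complex.exp_re, him]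
  rw [abs_lt] at harg
  exact mul_pos (Real.exp_pos _) (Real.cos_pos_of_mem_Ioo ⟨by linarith, by linarith⟩)

lemma cpow_half_sq (s : ℂ) : (s ^ (1 / 2 : ℂ)) ^ 2 = s := by
  rw [one_div]
  exact_mod_cast Complex.cpow_nat_inv_pow s two_ne_zero

lemma hasDerivAt_cpow_half {s : ℂ} (hs : 0 < s.re) :
    HasDerivAt (fun s : ℂ => s ^ (1 / 2 : ℂ)) (1 / (2 * s ^ (1 / 2 : ℂ))) s := by
  have hs' : s ∈ Complex.slitPlane := Or.inl hs
  have hs0 := Complex.slitPlane_ne_zero hs'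
  refine ((hasDerivAt_id s).cpow_const hs').congr_deriv ?_
  have hu0 : s ^ (1 / 2 : ℂ) ≠ 0 := by simp [Complex.cpow_eq_zero_iff, hs0]
  have h2 := cpow_half_sq s
  rw [id, Complex.cpow_sub _ _ hs0, Complex.cpow_one]
  generalize s ^ (1 / 2 : ℂ) = u at *
  subst h2
  field_simp

/-- A primitive of `s ^ (1 / 2) * exp (α ^ 2 / s + β ^ 2 * s)` in the right half plane together with
its approximate values away from the unit disc. -/
lemma exists_bessel_primitive {α β μ : ℝ} (hα : 0 < α) (hαβ : α ≤ β) (hμ : 1 ≤ μ)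
    (hμdef : μ = 2 * α * β) :
    ∃ F : ℂ → ℂ, (∀ s : ℂ, 0 < s.re → HasDerivAt F
        (β ^ 2 * (s ^ (1 / 2 : ℂ) * Complex.exp (α ^ 2 / s + β ^ 2 * s))) s) ∧
      ∀ (s : ℂ) (ε : ℝ), (ε = 1 ∨ ε = -1) → 0 < s.re → 1 ≤ ‖s‖ → 0 ≤ ε * s.im →
        ‖F s - ε * (Complex.I * (√π / (4 * β) *
          ((μ - 1) * rexp μ - (1 + μ) * rexp (-μ))))‖ ≤
        ‖Complex.exp (α ^ 2 / s + β ^ 2 * s)‖ * (‖s ^ (1 / 2 : ℂ)‖ + α * √π) := by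
  obtain ⟨W, hW, hodd, hWb⟩ := exists_gaussian_primitive
  have hβ : 0 < β := hα.trans_le hαβ
  have hβ0 : (β : ℂ) ≠ 0 := by exact_mod_cast hβ.ne'
  have hW' : ∀ ε : ℝ, (ε = 1 ∨ ε = -1) → ∀ z : ℂ, ε * z.re ≤ 0 →
      ‖W z + ε * (√π / 2)‖ ≤ √π / 2 * rexp (-(z ^ 2).re) := by
    rintro ε (rfl | rfl) z hz
    · have h := hWb (-z) (by simpa using hz)
      rw [neg_sq] at h
      rwa [show W z + (1 : ℝ) * (√π / 2 : ℂ) = -(W (-z) - √π / 2) by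
        rw [hodd]; push_cast; ring, norm_neg]
    · have h := hWb z (by simpa using hz)
      convert h using 2
      push_cast; ring
  let u : ℂ → ℂ := fun s => s ^ (1 / 2 : ℂ)
  let E : ℂ → ℂ := fun s => Complex.exp (α ^ 2 / s + β ^ 2 * s)
  have hexp : ∀ (s : ℂ) (δ : ℂ), δ ^ 2 = 1 → 0 < s.re →
      -(Complex.I * (β * u s + δ * (α / u s))) ^ 2 = α ^ 2 / s + β ^ 2 * s + δ * μ := by
    intro s δ hδ hs
    have hs0 : s ≠ 0 := fun h => by simp [h] at hs
    have hu0 : u s ≠ 0 := by simp [u, Complex.cpow_eq_zero_iff, hs0]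
    have h2 : u s ^ 2 = s := cpow_half_sq s
    rw [mul_pow, Complex.I_sq, hμdef]
    push_cast
    generalize u s = v at *
    subst h2
    field_simp
    linear_combination (α : ℂ) ^ 2 * hδ
  let F : ℂ → ℂ := fun s => u s * E s + Complex.I / (2 * β) *
    ((1 + μ) * rexp (-μ) * W (Complex.I * (β * u s + 1 * (α / u s))) +
      (1 - μ) * rexp μ * W (Complex.I * (β * u s + -1 * (α / u s))))
  refine ⟨F, fun s hs => ?_, fun s ε hε hs hs1 him => ?_⟩
  · have hs0 : s ≠ 0 := fun h => by simp [h] at hs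
    have hu0 : u s ≠ 0 := by simp [u, Complex.cpow_eq_zero_iff, hs0]
    have h2 : u s ^ 2 = s := cpow_half_sq s
    have hu : HasDerivAt u (1 / (2 * u s)) s := hasDerivAt_cpow_half hs
    have hE : HasDerivAt E (E s * (-α ^ 2 / s ^ 2 + β ^ 2)) s := by
      refine HasDerivAt.cexp ?_
      refine (((hasDerivAt_const s ((α : ℂ) ^ 2)).div (hasDerivAt_id s) hs0).add
        ((hasDerivAt_id s).const_mul ((β : ℂ) ^ 2))).congr_deriv ?_
      simp
    have hz : ∀ δ : ℂ, HasDerivAt (fun s => Complex.I * (β * u s + δ * (α / u s)))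
        (Complex.I * (β * (1 / (2 * u s)) + δ * (-(α * (1 / (2 * u s))) / u s ^ 2))) s := by
      intro δ
      refine HasDerivAt.const_mul _ ((hu.const_mul _).add (HasDerivAt.const_mul _ ?_))
      refine ((hasDerivAt_const s (α : ℂ)).div hu hu0).congr_deriv ?_
      simp
    have hWz : ∀ δ : ℂ, δ ^ 2 = 1 →
        HasDerivAt (fun s => W (Complex.I * (β * u s + δ * (α / u s))))
        (E s * Complex.exp (δ * μ) *
          (Complex.I * (β * (1 / (2 * u s)) + δ * (-(α * (1 / (2 * u s))) / u s ^ 2)))) s := by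
      intro δ hδ
      refine ((hW _).comp s (hz δ)).congr_deriv ?_
      rw [hexp s δ hδ hs, Complex.exp_add]
    refine ((hu.mul hE).add ((((hWz 1 (by norm_num)).const_mul _).add
      ((hWz (-1) (by norm_num)).const_mul _)).const_mul _)).congr_deriv ?_
    have e1 : ((rexp (-μ) : ℝ) : ℂ) * Complex.exp (1 * μ) = 1 := by
      rw [Complex.ofReal_exp, ← Complex.exp_add]; simp
    have e2 : ((rexp μ : ℝ) : ℂ) * Complex.exp (-1 * μ) = 1 := by
      rw [Complex.ofReal_exp, ← Complex.exp_add]; simp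
    change _ = (β : ℂ) ^ 2 * (u s * E s)
    have e3 : (1 / (2 * u s) * E s + u s * (E s * (-α ^ 2 / s ^ 2 + β ^ 2)) +
        Complex.I / (2 * β) * ((1 + μ) * (Complex.I * (β * (1 / (2 * u s)) +
          1 * (-(α * (1 / (2 * u s))) / u s ^ 2))) + (1 - μ) *
          (Complex.I * (β * (1 / (2 * u s)) + -1 * (-(α * (1 / (2 * u s))) / u s ^ 2)))) * E s) =
        (β : ℂ) ^ 2 * (u s * E s) := by
      rw [hμdef]
      push_cast
      generalize E s = e at *
      clear hWz hz hE hu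
      generalize u s = v at *
      subst h2
      field_simp
      rw [Complex.I_sq]
      ring
    rw [← e3]
    linear_combination (Complex.I / (2 * β) * (1 + μ) * E s *
      (Complex.I * (β * (1 / (2 * u s)) + 1 * (-(α * (1 / (2 * u s))) / u s ^ 2)))) * e1 +
      (Complex.I / (2 * β) * (1 - μ) * E s *
      (Complex.I * (β * (1 / (2 * u s)) + -1 * (-(α * (1 / (2 * u s))) / u s ^ 2)))) * e2
  · have hs0 : s ≠ 0 := fun h => by simp [h] at hs
    have hu0 : u s ≠ 0 := by simp [u, Complex.cpow_eq_zero_iff, hs0]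
    have h2 : u s ^ 2 = s := cpow_half_sq s
    have hure : 0 < (u s).re := cpow_half_re_pos hs
    have huim : 0 ≤ ε * (u s).im := by
      have h3 : s.im = 2 * (u s).re * (u s).im := by
        conv_lhs => rw [← h2]
        simp [sq]; ring
      rw [h3] at him
      by_contra! h4
      nlinarith
    have hun : 1 ≤ Complex.normSq (u s) := by
      rw [Complex.normSq_eq_norm_sq, ← norm_pow, h2]
      exact hs1
    have hz : ∀ δ : ℝ, (δ = 1 ∨ δ = -1) →
        ‖W (Complex.I * (β * u s + δ * (α / u s))) + ε * (√π / 2)‖ ≤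
        √π / 2 * (‖E s‖ * rexp (δ * μ)) := by
      intro δ hδ
      have hδ2 : (δ : ℂ) ^ 2 = 1 := by rcases hδ with rfl | rfl <;> norm_num
      have hre : (Complex.I * (β * u s + δ * (α / u s))).re =
          -((u s).im * (β - δ * α / Complex.normSq (u s))) := by
        rw [Complex.I_mul_re, Complex.add_im, Complex.im_ofReal_mul, Complex.im_ofReal_mul,
          div_eq_mul_inv, Complex.im_ofReal_mul, Complex.inv_im]
        ring
      refine (hW' ε hε _ ?_).trans_eq ?_
      · have h5 : 0 ≤ β - δ * α / Complex.normSq (u s) := by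
          rw [sub_nonneg, div_le_iff₀ (by linarith)]
          rcases hδ with rfl | rfl <;> nlinarith
        rw [hre]
        nlinarith
      · rw [← Complex.neg_re, hexp s δ hδ2 hs, Complex.norm_exp, ← Real.exp_add, Complex.add_re,
          Complex.re_ofReal_mul, Complex.ofReal_re]
    have hp := hz 1 (Or.inl rfl)
    have hm := hz (-1) (Or.inr rfl)
    rw [Complex.ofReal_one, one_mul μ] at hp
    rw [Complex.ofReal_neg, Complex.ofReal_one, neg_one_mul μ] at hm
    set z1 := W (Complex.I * (β * u s + 1 * (α / u s))) with hz1
    set z2 := W (Complex.I * (β * u s + -1 * (α / u s))) with hz2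
    have key : F s - ε * (Complex.I * (√π / (4 * β) *
          ((μ - 1) * rexp μ - (1 + μ) * rexp (-μ)))) = u s * E s + Complex.I / (2 * β) *
        ((1 + μ) * rexp (-μ) * (z1 + ε * (√π / 2)) + (1 - μ) * rexp μ * (z2 + ε * (√π / 2))) := by
      simp only [F]
      rw [← hz1, ← hz2]
      field_simp
      ring
    rw [key]
    change _ ≤ ‖E s‖ * (‖u s‖ + α * √π)
    have n1 : ‖(1 + μ : ℂ)‖ = 1 + μ := by
      rw [← Complex.ofReal_one, ← Complex.ofReal_add, Complex.norm_real,
        Real.norm_of_nonneg (by linarith)]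
    have n2 : ‖(1 - μ : ℂ)‖ = μ - 1 := by
      rw [← Complex.ofReal_one, ← Complex.ofReal_sub, Complex.norm_real,
        Real.norm_of_nonpos (by linarith), neg_sub]
    have n3 : ‖Complex.I / (2 * β)‖ = 1 / (2 * β) := by
      rw [norm_div, Complex.norm_I, norm_mul, Complex.norm_ofNat, Complex.norm_real,
        Real.norm_of_nonneg hβ.le]
    have n4 : ‖((rexp μ : ℝ) : ℂ)‖ = rexp μ := by
      rw [Complex.norm_real, Real.norm_of_nonneg (Real.exp_pos _).le]
    have n5 : ‖((rexp (-μ) : ℝ) : ℂ)‖ = rexp (-μ) := by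
      rw [Complex.norm_real, Real.norm_of_nonneg (Real.exp_pos _).le]
    have hprod : rexp (-μ) * rexp μ = 1 := by rw [← Real.exp_add]; simp
    calc _ ≤ ‖u s‖ * ‖E s‖ + 1 / (2 * β) * ((1 + μ) * rexp (-μ) * (√π / 2 * (‖E s‖ * rexp μ)) +
          (μ - 1) * rexp μ * (√π / 2 * (‖E s‖ * rexp (-μ)))) := by
          refine (norm_add_le _ _).trans ?_
          rw [norm_mul, norm_mul _ (_ + _), n3]
          gcongr
          refine (norm_add_le _ _).trans ?_
          rw [norm_mul, norm_mul, norm_mul, norm_mul, n1, n2, n4, n5]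
          have := sub_nonneg.2 hμ
          gcongr
      _ = ‖u s‖ * ‖E s‖ + 1 / (2 * β) * (√π * ‖E s‖ * μ * (rexp (-μ) * rexp μ)) := by ring
      _ = ‖E s‖ * (‖u s‖ + α * √π) := by
          rw [hprod, hμdef]
          field_simp

/-- Evaluation of the truncated Bessel integral of order `3 / 2`. -/
lemma norm_bessel_integral_sub_le {α β μ y : ℝ} (hα : 0 < α) (hαβ : α ≤ β) (hμ : 1 ≤ μ)
    (hμdef : μ = 2 * α * β) (hy : 0 < y) (hy' : y ≤ 1 / 36) :
    ‖(∫ x in (-1 : ℝ)..1, ((y : ℂ) + x * Complex.I) ^ (1 / 2 : ℂ) *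
        Complex.exp (α ^ 2 / (y + x * Complex.I) + β ^ 2 * (y + x * Complex.I))) -
      ((√π / (2 * β ^ 3) * ((μ - 1) * rexp μ - (1 + μ) * rexp (-μ)) : ℝ) : ℂ)‖ ≤
      2 / β ^ 2 * (rexp ((α ^ 2 + β ^ 2) * y) * (1.03 + α * √π)) := by
  obtain ⟨F, hF, hb⟩ := exists_bessel_primitive hα hαβ hμ hμdef
  have hβ : 0 < β := hα.trans_le hαβ
  have hβ0 : (β : ℂ) ≠ 0 := by exact_mod_cast hβ.ne'
  set M : ℂ := Complex.I * (√π / (4 * β) * ((μ - 1) * rexp μ - (1 + μ) * rexp (-μ))) with hM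
  have hend : ∀ ε : ℝ, (ε = 1 ∨ ε = -1) → ‖F (y + ε * Complex.I) - ε * M‖ ≤
      rexp ((α ^ 2 + β ^ 2) * y) * (1.03 + α * √π) := by
    intro ε hε
    have hε2 : ε ^ 2 = 1 := by rcases hε with rfl | rfl <;> norm_num
    set s : ℂ := y + ε * Complex.I with hs
    have hre : s.re = y := by simp [hs]
    have him : s.im = ε := by simp [hs]
    have hsq : ‖s‖ ^ 2 = y ^ 2 + 1 := by
      rw [← Complex.normSq_eq_norm_sq, Complex.normSq_apply, hre, him]
      linarith
    have h := hb s ε hε (hre ▸ hy) (by nlinarith [norm_nonneg s]) (by rw [him]; nlinarith)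
    refine h.trans ?_
    have hu : ‖s ^ (1 / 2 : ℂ)‖ ≤ 1.03 := by
      refine abs_le_of_sq_le_sq' ?_ (by norm_num) |>.2
      rw [← norm_pow, cpow_half_sq]
      nlinarith [norm_nonneg s]
    have hE : ‖Complex.exp (α ^ 2 / s + β ^ 2 * s)‖ ≤ rexp ((α ^ 2 + β ^ 2) * y) := by
      rw [Complex.norm_exp, Real.exp_le_exp, Complex.add_re, ← Complex.ofReal_pow,
        ← Complex.ofReal_pow, Complex.re_ofReal_mul, div_eq_mul_inv, Complex.re_ofReal_mul,
        Complex.inv_re, Complex.normSq_eq_norm_sq, hsq, hre, add_mul]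
      gcongr
      exact div_le_self hy.le (by nlinarith)
    gcongr
  have hF_int : (∫ x in (-1 : ℝ)..1, ((y : ℂ) + x * Complex.I) ^ (1 / 2 : ℂ) *
        Complex.exp (α ^ 2 / (y + x * Complex.I) + β ^ 2 * (y + x * Complex.I))) =
      (F (y + (1 : ℝ) * Complex.I) - F (y + (-1 : ℝ) * Complex.I)) / (Complex.I * β ^ 2) := by
    rw [eq_div_iff (by simp [hβ0]), mul_comm, ← intervalIntegral.integral_const_mul]
    refine intervalIntegral.integral_eq_sub_of_hasDerivAt
      (f := fun x : ℝ => F (y + x * Complex.I)) (fun x _ => ?_) ?_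
    · have hl : HasDerivAt (fun x : ℝ => (y : ℂ) + x * Complex.I) (1 * Complex.I) x :=
        ((hasDerivAt_id x).ofReal_comp.mul_const Complex.I).const_add _
      refine ((hF (y + x * Complex.I) (by simpa using hy)).scomp x hl).congr_deriv ?_
      rw [smul_eq_mul]
      ring
    · refine ContinuousOn.intervalIntegrable fun x _ => ContinuousAt.continuousWithinAt ?_
      have hs : (y : ℂ) + x * Complex.I ∈ Complex.slitPlane := Or.inl (by simpa using hy)
      have h0 : (y : ℂ) + x * Complex.I ≠ 0 := Complex.slitPlane_ne_zero hs
      refine continuousAt_const.mul (ContinuousAt.mul ?_ ?_)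
      · exact ContinuousAt.cpow (by fun_prop) continuousAt_const hs
      · exact ContinuousAt.cexp (by fun_prop (disch := exact h0))
  have key : (F (y + (1 : ℝ) * Complex.I) - F (y + (-1 : ℝ) * Complex.I)) / (Complex.I * β ^ 2) -
      ((√π / (2 * β ^ 3) * ((μ - 1) * rexp μ - (1 + μ) * rexp (-μ)) : ℝ) : ℂ) =
      ((F (y + (1 : ℝ) * Complex.I) - (1 : ℝ) * M) -
        (F (y + (-1 : ℝ) * Complex.I) - (-1 : ℝ) * M)) / (Complex.I * β ^ 2) := by
    rw [hM]
    push_cast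
    field_simp
    ring
  rw [hF_int, key, norm_div, norm_mul, Complex.norm_I, one_mul, norm_pow, Complex.norm_real,
    Real.norm_of_nonneg hβ.le, div_mul_eq_mul_div]
  gcongr
  refine (norm_sub_le _ _).trans ?_
  linarith [hend 1 (Or.inl rfl), hend (-1) (Or.inr rfl)]

/-- The main term approximates the overpartition numbers with an explicit error. -/
lemma abs_pbar_sub_That_le {n : ℕ} (hn : 85 ≤ n) :
    |pbar n - That n| ≤ rexp (π * √n / 4) * (0.15 * rexp (π * √n / 9) + 1.3) := by
  have hn' : (85 : ℝ) ≤ n := by exact_mod_cast hn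
  have hn0 : (0 : ℝ) < n := by linarith
  obtain ⟨x, hx, hx2⟩ : ∃ x : ℝ, 0 < x ∧ x ^ 2 = n := ⟨√n, by positivity, Real.sq_sqrt hn0.le⟩
  have hsx : √(n : ℝ) = x := by rw [← hx2, Real.sqrt_sq hx.le]
  have hx9 : 9 ≤ x := by nlinarith
  have hpi3 := Real.pi_gt_three
  have hpi := Real.pi_lt_d2
  obtain ⟨p, hp, hp2⟩ : ∃ p : ℝ, 0 < p ∧ p ^ 2 = π := ⟨√π, by positivity, Real.sq_sqrt pi_pos.le⟩
  have hsp : √π = p := by rw [← hp2, Real.sqrt_sq hp.le]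
  have hy : 0 < 1 / (4 * x) := by positivity
  have hy' : 1 / (4 * x) ≤ 1 / 36 := by
    apply one_div_le_one_div_of_le <;> linarith
  have hμ : 1 ≤ π * x := by nlinarith
  have h1 := norm_pbar_sub_integral_le n hy hy'
  have h2 := norm_bessel_integral_sub_le (α := p / 2) (β := p * x) (μ := π * x) (by positivity)
    (by nlinarith) hμ (by rw [← hp2]; ring) hy hy'
  have e1 : (((p / 2 : ℝ) : ℂ)) ^ 2 = π / 4 := by
    rw [← hp2]; push_cast; ring
  have e2 : (((p * x : ℝ) : ℂ)) ^ 2 = π * n := by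
    rw [show (n : ℂ) = ((n : ℝ) : ℂ) by simp, ← hp2, ← hx2]; push_cast; ring
  rw [e1, e2] at h2
  set J := ∫ t in (-1 : ℝ)..1, (((1 / (4 * x) : ℝ) : ℂ) + t * Complex.I) ^ (1 / 2 : ℂ) *
      Complex.exp (π / 4 / ((1 / (4 * x) : ℝ) + t * Complex.I) +
        π * n * ((1 / (4 * x) : ℝ) + t * Complex.I))
  have e3 : π * n * (1 / (4 * x)) = π * x / 4 := by
    rw [← hx2]; field_simp
  have e4 : π / (36 * (1 / (4 * x))) = π * x / 9 := by
    field_simp; norm_num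
  rw [e3, e4] at h1
  set R : ℝ := √π / (2 * (p * x) ^ 3) * ((π * x - 1) * rexp (π * x) -
    (1 + π * x) * rexp (-(π * x))) with hR
  have e5 : That n - 1 / 4 * R = (1 + π * x) / (8 * π * x ^ 3) * rexp (-(π * x)) := by
    rw [That, hR, hsx, hsp, ← hx2, ← hp2]
    field_simp
    ring
  have h3 : |That n - 1 / 4 * R| ≤ 0.01 := by
    have h4 : rexp (-(π * x)) ≤ 1 := Real.exp_le_one_iff.2 (by linarith)
    have h5 : (1 + π * x) / (8 * π * x ^ 3) ≤ 0.01 := by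
      rw [div_le_iff₀ (by positivity)]
      have : 81 * x ≤ x ^ 3 := by nlinarith
      nlinarith
    rw [e5, abs_of_nonneg (by positivity)]
    calc _ ≤ (0.01 : ℝ) * 1 := by gcongr
      _ = 0.01 := mul_one _
  have h6 : rexp (((p / 2) ^ 2 + (p * x) ^ 2) * (1 / (4 * x))) ≤ rexp (π * x / 4) * 1.1 := by
    have e6 : ((p / 2) ^ 2 + (p * x) ^ 2) * (1 / (4 * x)) =
        π * x / 4 + π / 4 * (1 / (4 * x)) := by
      rw [← hp2]; field_simp; ring
    rw [e6, Real.exp_add]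
    gcongr
    have h7 : π / 4 * (1 / (4 * x)) ≤ 1 / 40 := by nlinarith
    calc rexp (π / 4 * (1 / (4 * x))) ≤ rexp (1 / 40) := Real.exp_le_exp.2 h7
      _ ≤ 1.1 := by
        rw [← Real.le_log_iff_exp_le (by norm_num)]
        have := Real.one_sub_inv_le_log_of_pos (x := 1.1) (by norm_num)
        norm_num at this ⊢
        linarith
  have h8 : 2 / (p * x) ^ 2 * (rexp (((p / 2) ^ 2 + (p * x) ^ 2) * (1 / (4 * x))) *
      (1.03 + p / 2 * √π)) ≤ 0.1 * rexp (π * x / 4) := by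
    have h9 : 2 / (p * x) ^ 2 ≤ 0.01 := by
      rw [mul_pow, hp2, hx2, div_le_iff₀ (by positivity)]
      nlinarith
    have h10 : 1.03 + p / 2 * √π ≤ 3 := by
      rw [hsp]
      nlinarith
    calc _ ≤ 0.01 * (rexp (π * x / 4) * 1.1 * 3) := by gcongr
      _ ≤ _ := by linarith [Real.exp_pos (π * x / 4)]
  have h11 : ‖(pbar n : ℂ) - That n‖ ≤ rexp (π * x / 4) * (0.15 * rexp (π * x / 9) + 1.2) +
      (1 / 4 * (0.1 * rexp (π * x / 4)) + 0.01) := by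
    have e7 : (pbar n : ℂ) - That n = ((pbar n : ℂ) - 1 / 4 * J) +
        (1 / 4 * (J - R) - ((That n - 1 / 4 * R : ℝ) : ℂ)) := by
      push_cast; ring
    rw [e7]
    refine (norm_add_le _ _).trans (add_le_add h1 ((norm_sub_le _ _).trans (add_le_add ?_ ?_)))
    · rw [norm_mul]
      refine mul_le_mul (by norm_num) (h2.trans h8) (norm_nonneg _) (by norm_num)
    · rwa [Complex.norm_real]
  rw [← Complex.ofReal_natCast, ← Complex.ofReal_sub, Complex.norm_real, Real.norm_eq_abs] at h11
  rw [hsx]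
  refine h11.trans ?_
  have : 1 ≤ rexp (π * x / 4) := Real.one_le_exp (by positivity)
  linarith

lemma abs_log_pbar_div_That_le {n : ℕ} (hn : 85 ≤ n) :
    |Real.log (pbar n / That n)| ≤ 25 * rexp (-(π * √n / 2)) := by
  have hn' : (85 : ℝ) ≤ n := by exact_mod_cast hn
  have hn0 : (0 : ℝ) < n := by linarith
  have h := abs_pbar_sub_That_le hn
  have hT : That n = 1 / (8 * (n : ℝ)) * (1 - 1 / (π * √n)) * rexp (π * √n) := rfl
  obtain ⟨x, hx, hx2⟩ : ∃ x : ℝ, 0 < x ∧ x ^ 2 = n := ⟨√n, by positivity, Real.sq_sqrt hn0.le⟩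
  rw [← hx2, Real.sqrt_sq hx.le] at h hT ⊢
  have hx9 : 9 ≤ x := by nlinarith
  have hpi3 := Real.pi_gt_d2
  obtain ⟨t, ht⟩ : ∃ t, t = π * x / 4 := ⟨_, rfl⟩
  have ht7 : 7 ≤ t := by nlinarith
  have hxt : x ^ 2 ≤ 1.63 * t ^ 2 := by
    rw [ht]
    nlinarith [mul_pos hx hx, mul_self_le_mul_self (by norm_num) hpi3.le]
  rw [← ht, show π * x / 9 = 4 * t / 9 by rw [ht]; ring] at h
  rw [show π * x / 2 = 2 * t by rw [ht]; ring]
  rw [show π * x = 4 * t by rw [ht]; ring] at hT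
  have hTl : 0.96 / (8 * x ^ 2) * rexp (4 * t) ≤ That n := by
    rw [hT, div_eq_mul_one_div, mul_comm 0.96]
    gcongr
    have : 1 / (4 * t) ≤ 1 / 28 := by apply one_div_le_one_div_of_le <;> linarith
    norm_num at this ⊢
    linarith
  have hTpos : 0 < That n := lt_of_lt_of_le (by positivity) hTl
  have hE1 : 1 + 4 * t / 9 ≤ rexp (4 * t / 9) := by linarith [Real.add_one_le_exp (4 * t / 9)]
  have hE2 : t ^ 2 ≤ 2.9 * rexp (5 * t / 9) := by
    have h1 := Real.sum_le_exp_of_nonneg (x := 5 * t / 9) (by positivity) 4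
    simp only [Finset.sum_range_succ, Finset.sum_range_zero, Nat.factorial] at h1
    norm_num at h1
    nlinarith [mul_nonneg (sub_nonneg.2 ht7) (sq_nonneg t)]
  have hmul : rexp (5 * t / 9) * rexp (4 * t / 9) = rexp t := by
    rw [← Real.exp_add]; ring_nf
  have hδ : |pbar n - That n| ≤ 20 * rexp (-(2 * t)) * That n := by
    have e : rexp (-(2 * t)) * rexp (4 * t) = rexp t * rexp t := by
      rw [← Real.exp_add, ← Real.exp_add]; ring_nf
    calc _ ≤ rexp t * (0.15 * rexp (4 * t / 9) + 1.3) := h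
      _ ≤ rexp t * (0.48 * rexp (4 * t / 9)) := by gcongr; linarith
      _ ≤ 20 * (0.96 / (8 * x ^ 2)) * (rexp t * rexp t) := by
        have h3 : 0.48 * rexp (4 * t / 9) * x ^ 2 ≤ 2.4 * rexp t := by
          rw [← hmul]
          have := Real.exp_pos (4 * t / 9)
          nlinarith
        rw [show 20 * (0.96 / (8 * x ^ 2)) * (rexp t * rexp t) =
          rexp t * (2.4 * rexp t / x ^ 2) by field_simp; ring]
        gcongr
        rwa [le_div_iff₀ (by positivity)]
      _ = 20 * rexp (-(2 * t)) * (0.96 / (8 * x ^ 2) * rexp (4 * t)) := by rw [← e]; ring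
      _ ≤ _ := by gcongr
  set d := rexp (-(2 * t)) with hd
  have hd0 : 0 < d := Real.exp_pos _
  have hd1 : 20 * d ≤ 1 / 5 := by
    have h1 := Real.quadratic_le_exp_of_nonneg (x := 2 * t) (by positivity)
    rw [hd, Real.exp_neg, ← div_eq_mul_inv, div_le_iff₀ (Real.exp_pos _)]
    nlinarith
  obtain ⟨h1, h2⟩ := abs_le.1 hδ
  have hr1 : 1 - 20 * d ≤ pbar n / That n := by
    rw [le_div_iff₀ hTpos]; linarith
  have hr2 : pbar n / That n ≤ 1 + 20 * d := by
    rw [div_le_iff₀ hTpos]; linarith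
  set ρ := (pbar n : ℝ) / That n
  have hρ : 0 < ρ := by linarith
  rw [abs_le]
  constructor
  · refine le_trans ?_ (Real.one_sub_inv_le_log_of_pos hρ)
    have : ρ⁻¹ ≤ 1 + 25 * d := by
      rw [inv_le_iff_one_le_mul₀ hρ]
      nlinarith
    linarith
  · linarith [Real.log_le_sub_one_of_pos hρ]

lemma abs_iterate_fdiff_le (r : ℕ) {f : ℕ → ℝ} {n : ℕ} {B : ℝ} (h : ∀ m, n ≤ m → |f m| ≤ B) :
    |(fdiff^[r] f) n| ≤ 2 ^ r * B := by
  induction r generalizing f B with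
  | zero => simpa using h n le_rfl
  | succ r ih =>
    rw [Function.iterate_succ_apply, pow_succ, mul_assoc]
    refine ih fun m hm => ?_
    have h1 := h m hm
    have h2 := h (m + 1) (hm.trans m.le_succ)
    exact (abs_sub _ _).trans (by linarith)

lemma log_two_add_two_mul_log_le {L : ℝ} (hL : 2 * Real.log 2 ≤ L) :
    Real.log 2 + 2 * Real.log L ≤ L + Real.log L / (2 * L) := by
  have l1 := Real.log_two_gt_d9
  have l2 := Real.log_two_lt_d9
  have hL1 : 1.38 ≤ L := by linarith
  have hL0 : 0 < L := by linarith
  have hlog : 0 ≤ Real.log L := Real.log_nonneg (by linarith)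
  rcases le_total L 4 with h4 | h4
  · have h1 : Real.log L ≤ Real.log 2 + (L / 2 - 1) := by
      have := Real.log_le_sub_one_of_pos (x := L / 2) (by positivity)
      rw [Real.log_div hL0.ne' two_ne_zero] at this
      linarith
    have h2 : 0.08 ≤ Real.log L / (2 * L) := by
      rw [le_div_iff₀ (by positivity)]
      refine le_trans ?_ (Real.one_sub_inv_le_log_of_pos hL0)
      rw [le_sub_comm, inv_le_iff_one_le_mul₀ hL0]
      nlinarith
    linarith
  · have h1 : Real.log L ≤ Real.log 4 + (L / 4 - 1) := by
      have := Real.log_le_sub_one_of_pos (x := L / 4) (by positivity)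
      rw [Real.log_div hL0.ne' four_ne_zero] at this
      linarith
    have h2 : Real.log 4 = 2 * Real.log 2 := by
      rw [show (4 : ℝ) = 2 ^ 2 by norm_num, Real.log_pow]; norm_num
    have h3 : 0 ≤ Real.log L / (2 * L) := by positivity
    linarith

/-- `N₀ m` lies beyond the last point where `m * log x` exceeds `x`. -/
lemma mul_log_le_of_N₀_le {m : ℕ} (hm : 4 ≤ m) {x : ℝ} (hx0 : 0 < x) (hx : N₀ m ≤ x) :
    m * Real.log x ≤ x := by
  have hm' : (4 : ℝ) ≤ m := by exact_mod_cast hm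
  have hm0 : (0 : ℝ) < m := by linarith
  rw [N₀, if_neg (by omega)] at hx
  set L := Real.log m with hL
  have hL2 : 2 * Real.log 2 ≤ L := by
    have : Real.log 4 = 2 * Real.log 2 := by
      rw [show (4 : ℝ) = 2 ^ 2 by norm_num, Real.log_pow]; norm_num
    rw [← this]
    exact Real.log_le_log (by norm_num) hm'
  have hL1 : 1 ≤ L := by linarith [Real.log_two_gt_d9]
  have h1 := log_two_add_two_mul_log_le hL2
  have h2 := Real.log_le_sub_one_of_pos (x := x / (2 * m * L)) (by positivity)
  rw [Real.log_div hx0.ne' (by positivity), Real.log_mul (by positivity) (by positivity),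
    Real.log_mul two_ne_zero hm0.ne', ← hL] at h2
  have h3 : m * Real.log x ≤ m * (Real.log 2 + L + Real.log L - 1) + x / (2 * L) := by
    calc m * Real.log x ≤ m * (Real.log 2 + L + Real.log L - 1 + x / (2 * m * L)) := by
          gcongr; linarith
      _ = _ := by field_simp
  have h4 : (2 * m * L - m * Real.log L) * (1 - 1 / (2 * L)) ≤ x * (1 - 1 / (2 * L)) := by
    have : 1 / (2 * L) ≤ 1 := by rw [div_le_one (by positivity)]; linarith
    gcongr
  have h5 : (2 * m * L - m * Real.log L) * (1 - 1 / (2 * L)) =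
      m * (2 * L - 1 - Real.log L + Real.log L / (2 * L)) := by
    field_simp; ring
  have h6 : m * (Real.log 2 + L + Real.log L - 1) ≤
      m * (2 * L - 1 - Real.log L + Real.log L / (2 * L)) := by
    gcongr ?_ * ?_; linarith
  have h7 : x * (1 - 1 / (2 * L)) = x - x / (2 * L) := by ring
  linarith

theorem stmt7 (r : ℕ) (hr : 1 ≤ r) (n : ℕ) (hn : N₁ r ≤ (n : ℝ)) :
    |G r n| < 1 / (n : ℝ) ^ ((r : ℝ) + 3/2) := by
  have hn' : (85 : ℝ) ≤ n := (le_max_left _ _).trans hn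
  have hn0 : (0 : ℝ) < n := by linarith
  have hn85 : 85 ≤ n := by exact_mod_cast hn'
  have hpi := Real.pi_gt_d2
  set x := π * √n / 2 with hx
  have hx0 : 0 < x := by positivity
  have hx2 : x ^ 2 = π ^ 2 / 4 * n := by
    rw [hx, div_pow, mul_pow, Real.sq_sqrt hn0.le]; ring
  have hN : N₀ (2 * r + 2) ≤ x := by
    refine (abs_le_of_sq_le_sq' ?_ hx0.le).2
    have h := (Int.le_ceil (4 / π ^ 2 * N₀ (2 * r + 2) ^ 2)).trans ((le_max_right _ _).trans hn)
    rw [hx2]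
    calc N₀ (2 * r + 2) ^ 2 = π ^ 2 / 4 * (4 / π ^ 2 * N₀ (2 * r + 2) ^ 2) := by field_simp
      _ ≤ _ := by gcongr
  have hexp : (2.46 * (n : ℝ)) ^ (r + 1) ≤ rexp x := by
    have h := mul_log_le_of_N₀_le (by omega) hx0 hN
    rw [← Real.log_pow, Real.log_le_iff_le_exp (by positivity)] at h
    refine le_trans ?_ h
    rw [show 2 * r + 2 = 2 * (r + 1) by ring, pow_mul, hx2]
    gcongr
    nlinarith
  have hsup : ∀ m, n ≤ m → |1 / (m : ℝ) * Real.log (pbar m / That m)| ≤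
      1 / n * (25 * rexp (-x)) := by
    intro m hm
    have hm' : (n : ℝ) ≤ m := by exact_mod_cast hm
    rw [abs_mul, abs_of_nonneg (by positivity)]
    refine mul_le_mul (by gcongr) ((abs_log_pbar_div_That_le (hn85.trans hm)).trans ?_)
      (abs_nonneg _) (by positivity)
    rw [hx]
    gcongr
  have hG : |G r n| ≤ 2 ^ r * (1 / n * (25 * rexp (-x))) := by
    rw [G, abs_mul, abs_pow, abs_neg, abs_one, one_pow, one_mul]
    exact abs_iterate_fdiff_le r hsup
  have hrpow : (n : ℝ) ^ ((r : ℝ) + 3 / 2) = n ^ (r + 1) * √n := by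
    rw [show (r : ℝ) + 3 / 2 = ((r + 1 : ℕ) : ℝ) + 1 / 2 by push_cast; ring,
      Real.rpow_add hn0, Real.rpow_natCast, Real.sqrt_eq_rpow]
  have hpow : (3 : ℝ) * 2 ^ r ≤ 2.46 ^ (r + 1) := by
    obtain ⟨k, rfl⟩ := Nat.exists_eq_add_of_le' hr
    have : (2 : ℝ) ^ k ≤ 2.46 ^ k := by gcongr; norm_num
    rw [pow_succ, pow_succ, pow_succ]
    linarith [pow_pos (show (0 : ℝ) < 2 by norm_num) k]
  have hsq : (9.2 : ℝ) ≤ √n := Real.le_sqrt_of_sq_le (by norm_num; linarith)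
  refine hG.trans_lt ?_
  rw [hrpow, lt_div_iff₀ (by positivity), Real.exp_neg]
  have hlt : 25 * 2 ^ r * (n ^ (r + 1) * √n) < n * rexp x := by
    calc 25 * 2 ^ r * (n ^ (r + 1) * √n) < 3 * 9.2 * 2 ^ r * (n ^ (r + 1) * √n) := by
          gcongr; norm_num
      _ ≤ 3 * √n * 2 ^ r * (n ^ (r + 1) * √n) := by gcongr
      _ = n ^ (r + 1) * (3 * 2 ^ r) * √n ^ 2 := by ring
      _ ≤ n ^ (r + 1) * 2.46 ^ (r + 1) * √n ^ 2 := by gcongr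
      _ = n * (2.46 * n) ^ (r + 1) := by rw [Real.sq_sqrt hn0.le, mul_pow]; ring
      _ ≤ n * rexp x := by gcongr
  calc _ = 25 * 2 ^ r * (n ^ (r + 1) * √n) / (n * rexp x) := by field_simp
    _ < 1 := (div_lt_one (by positivity)).2 hlt
end

section
/- Let f : [1,∞) → ℝ be a function with continuous derivatives of all orders such that (−1)^{k−1}·f^{(k)}(t) > 0 for all integers k ≥ 1 and all t ≥ 1. Then for every integer r ≥ 1 and every real x ≥ 1, (−1)^{r−1}·f^{(r)}(x+r) ≤ (−1)^{r−1}·Δ^r f(x) ≤ (−1)^{r−1}·f^{(r)}(x). -/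
open Real

/-- Forward difference operator for functions of a real variable. -/
noncomputable def fdiffR (f : ℝ → ℝ) : ℝ → ℝ := fun x => f (x + 1) - f x

theorem hasDerivWithinAt_fdiffR {g : ℝ → ℝ} {g' : ℝ → ℝ} {a t : ℝ} (ht : a ≤ t)
    (hg : ∀ u, a ≤ u → HasDerivWithinAt g (g' u) (Set.Ici a) u) :
    HasDerivWithinAt (fdiffR g) (fdiffR g' t) (Set.Ici a) t := by
  have hshift : HasDerivWithinAt (fun u : ℝ => u + 1) 1 (Set.Ici a) t :=
    (hasDerivWithinAt_id t _).add_const 1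
  have hmaps : Set.MapsTo (fun u : ℝ => u + 1) (Set.Ici a) (Set.Ici a) := by
    intro u hu
    simp only [Set.mem_Ici] at hu ⊢
    linarith
  have hcomp := (hg (t + 1) (by linarith)).comp t hshift hmaps
  rw [mul_one] at hcomp
  exact hcomp.sub (hg t ht)

/-- Mean value theorem for iterated forward differences. -/
theorem exists_fdiffR_iterate_eq {a : ℝ} (r : ℕ) (g : ℕ → ℝ → ℝ)
    (hg : ∀ k t, a ≤ t → HasDerivWithinAt (g k) (g (k + 1) t) (Set.Ici a) t)
    {x : ℝ} (hx : a ≤ x) :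
    ∃ ξ ∈ Set.Icc x (x + r), (fdiffR^[r] (g 0)) x = g r ξ := by
  induction r generalizing g with
  | zero => exact ⟨x, by simp, rfl⟩
  | succ r ih =>
    obtain ⟨ξ, ⟨hxξ, hξr⟩, hξ⟩ := ih (fun k => fdiffR (g k))
      (fun k t ht => hasDerivWithinAt_fdiffR ht (hg k))
    obtain ⟨η, ⟨hξη, hηξ⟩, hη⟩ := exists_hasDerivAt_eq_slope (g r) (g (r + 1))
      (show ξ < ξ + 1 by linarith)
      (fun t ht => ((hg r t (by linarith [ht.1])).continuousWithinAt).mono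
        (fun u hu => by simp only [Set.mem_Ici]; linarith [hu.1]))
      (fun t ht => (hg r t (by linarith [ht.1])).hasDerivAt
        (Ici_mem_nhds (by linarith [ht.1])))
    refine ⟨η, ⟨by linarith, by push_cast; linarith⟩, ?_⟩
    rw [Function.iterate_succ_apply, hξ, hη, fdiffR]
    ring

theorem stmt8 (f : ℝ → ℝ) (hf : ContDiffOn ℝ (⊤ : ℕ∞) f (Set.Ici (1 : ℝ)))
    (hsign : ∀ k : ℕ, 1 ≤ k → ∀ t : ℝ, 1 ≤ t →
      0 < (-1 : ℝ) ^ (k - 1) * iteratedDerivWithin k f (Set.Ici (1 : ℝ)) t)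
    (r : ℕ) (hr : 1 ≤ r) (x : ℝ) (hx : 1 ≤ x) :
    (-1 : ℝ) ^ (r - 1) * iteratedDerivWithin r f (Set.Ici (1 : ℝ)) (x + r) ≤
      (-1 : ℝ) ^ (r - 1) * (fdiffR^[r] f) x ∧
    (-1 : ℝ) ^ (r - 1) * (fdiffR^[r] f) x ≤
      (-1 : ℝ) ^ (r - 1) * iteratedDerivWithin r f (Set.Ici (1 : ℝ)) x := by
  have hderiv (k : ℕ) (t : ℝ) (ht : 1 ≤ t) :
      HasDerivWithinAt (iteratedDerivWithin k f (Set.Ici (1 : ℝ)))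
        (iteratedDerivWithin (k + 1) f (Set.Ici (1 : ℝ)) t) (Set.Ici 1) t := by
    rw [iteratedDerivWithin_succ]
    exact (hf.differentiableOn_iteratedDerivWithin (by exact_mod_cast WithTop.coe_lt_top k)
      (uniqueDiffOn_Ici 1) t ht).hasDerivWithinAt
  have hanti : AntitoneOn
      (fun t => (-1 : ℝ) ^ (r - 1) * iteratedDerivWithin r f (Set.Ici (1 : ℝ)) t)
      (Set.Ici 1) := by
    have hd (t : ℝ) (ht : 1 ≤ t) := (hderiv r t ht).const_mul ((-1 : ℝ) ^ (r - 1))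
    refine antitoneOn_of_hasDerivWithinAt_nonpos (convex_Ici 1)
      (fun t ht => (hd t ht).continuousWithinAt)
      (fun t ht => (hd t (interior_subset ht)).mono interior_subset) fun t ht => ?_
    have h := hsign (r + 1) (by omega) t (interior_subset ht)
    obtain ⟨m, rfl⟩ := Nat.exists_eq_add_of_le' hr
    simp only [Nat.add_sub_cancel, pow_succ] at h ⊢
    linarith
  obtain ⟨ξ, ⟨hxξ, hξr⟩, hξ⟩ := exists_fdiffR_iterate_eq r
    (fun k => iteratedDerivWithin k f (Set.Ici (1 : ℝ))) hderiv hx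
  simp only [iteratedDerivWithin_zero] at hξ
  rw [hξ]
  have hξ1 : 1 ≤ ξ := hx.trans hxξ
  exact ⟨hanti hξ1 (hξ1.trans hξr) hξr, hanti hx hξ1 hxξ⟩
end
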